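/- arXiv:1210.4947 — 7 statements merged into one kernel-verified Lean document; each statement's English description precedes it below -/
import Mathlib

section
/- Let N ≥ 2, let m_1,…,m_N > 0, and let q = (q_1,…,q_N) be a candidate solution of the curved N-body problem in S³ of positive elliptic form, with r_i(t) > 0 for all i and t and with q_ij(t)² ≠ 1 for all i ≠ j and all t. Then q solves the equations of motion in S³ if and only if there exists a constant c such that α̇ = c / (Σ_{j=1}^N m_j r_j²) and, for every i = 1,…,N and every t: (1) ÿ_i = Σ_{j≠i} m_j (y_j − q_ij y_i)/(1 − q_ij²)^{3/2} − F_i y_i; (2) z̈_i = Σ_{j≠i} m_j (z_j − q_ij z_i)/(1 − q_ij²)^{3/2} − F_i z_i; (3) r_i α̈ + 2 ṙ_i α̇ = Σ_{j≠i} m_j r_j sin(a_j − a_i)/(1 − q_ij²)^{3/2}; where F_i := [ẏ_i² + ż_i² − (y_i ż_i − z_i ẏ_i)²]/(1 − y_i² − z_i²) + c² (1 − y_i² − z_i²)/[Σ_{j=1}^N m_j (1 − y_j² − z_j²)]². -/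
open Real Finset

/-- Two vectors agree iff their coordinates agree after a rotation. -/
lemma rotation_eq_iff (θ p s p' s' : ℝ) :
    (p * cos θ - s * sin θ = p' * cos θ - s' * sin θ ∧
      p * sin θ + s * cos θ = p' * sin θ + s' * cos θ) ↔ p = p' ∧ s = s' := by
  constructor
  · rintro ⟨h₁, h₂⟩
    have h := sin_sq_add_cos_sq θ
    constructor
    · linear_combination cos θ * h₁ + sin θ * h₂ - (p - p') * h
    · linear_combination cos θ * h₂ - sin θ * h₁ - (s - s') * h
  · rintro ⟨rfl, rfl⟩
    exact ⟨rfl, rfl⟩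

lemma ContDiff.hasDerivAt_deriv_of_two {f : ℝ → ℝ} (hf : ContDiff ℝ 2 f) (t : ℝ) :
    HasDerivAt f (deriv f t) t :=
  (hf.differentiable (by norm_num) t).hasDerivAt

lemma ContDiff.hasDerivAt_deriv_deriv {f : ℝ → ℝ} (hf : ContDiff ℝ 2 f) (t : ℝ) :
    HasDerivAt (deriv f) (deriv (deriv f) t) t := by
  have h : ContDiff ℝ (1 + 1) f := by simpa [one_add_one_eq_two] using hf
  have h' : ContDiff ℝ 1 (deriv f) := (contDiff_succ_iff_deriv.1 h).2.2
  exact (h'.differentiable (by norm_num) t).hasDerivAt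

lemma deriv_mul_cos_polar {α r : ℝ → ℝ} (hα : ContDiff ℝ 2 α)
    (hr : ContDiff ℝ 2 r) (b : ℝ) :
    deriv (fun t => r t * cos (α t + b)) =
      fun t => deriv r t * cos (α t + b) - r t * deriv α t * sin (α t + b) := by
  funext t
  have hθ := (hα.hasDerivAt_deriv_of_two t).add_const b
  refine (((hr.hasDerivAt_deriv_of_two t).fun_mul hθ.cos).congr_deriv ?_).deriv
  ring

lemma deriv_mul_sin_polar {α r : ℝ → ℝ} (hα : ContDiff ℝ 2 α)
    (hr : ContDiff ℝ 2 r) (b : ℝ) :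
    deriv (fun t => r t * sin (α t + b)) =
      fun t => deriv r t * sin (α t + b) + r t * deriv α t * cos (α t + b) := by
  funext t
  have hθ := (hα.hasDerivAt_deriv_of_two t).add_const b
  refine (((hr.hasDerivAt_deriv_of_two t).fun_mul hθ.sin).congr_deriv ?_).deriv
  ring

lemma deriv_deriv_mul_cos_polar {α r : ℝ → ℝ} (hα : ContDiff ℝ 2 α)
    (hr : ContDiff ℝ 2 r) (b : ℝ) (t : ℝ) :
    deriv (deriv fun t => r t * cos (α t + b)) t =
      (deriv (deriv r) t - r t * deriv α t ^ 2) * cos (α t + b) -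
        (r t * deriv (deriv α) t + 2 * deriv r t * deriv α t) * sin (α t + b) := by
  rw [deriv_mul_cos_polar hα hr b]
  have hθ := (hα.hasDerivAt_deriv_of_two t).add_const b
  refine ((((hr.hasDerivAt_deriv_deriv t).fun_mul hθ.cos).fun_sub
    (((hr.hasDerivAt_deriv_of_two t).fun_mul (hα.hasDerivAt_deriv_deriv t)).fun_mul
      hθ.sin)).congr_deriv ?_).deriv
  ring

lemma deriv_deriv_mul_sin_polar {α r : ℝ → ℝ} (hα : ContDiff ℝ 2 α)
    (hr : ContDiff ℝ 2 r) (b : ℝ) (t : ℝ) :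
    deriv (deriv fun t => r t * sin (α t + b)) t =
      (deriv (deriv r) t - r t * deriv α t ^ 2) * sin (α t + b) +
        (r t * deriv (deriv α) t + 2 * deriv r t * deriv α t) * cos (α t + b) := by
  rw [deriv_mul_sin_polar hα hr b]
  have hθ := (hα.hasDerivAt_deriv_of_two t).add_const b
  refine ((((hr.hasDerivAt_deriv_deriv t).fun_mul hθ.sin).fun_add
    (((hr.hasDerivAt_deriv_of_two t).fun_mul (hα.hasDerivAt_deriv_deriv t)).fun_mul
      hθ.cos)).congr_deriv ?_).deriv
  ring

lemma sphere_velocity_tangent {r y z : ℝ → ℝ} (hr : ContDiff ℝ 2 r)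
    (hy : ContDiff ℝ 2 y) (hz : ContDiff ℝ 2 z)
    (h : ∀ t, r t ^ 2 + y t ^ 2 + z t ^ 2 = 1) (t : ℝ) :
    r t * deriv r t + y t * deriv y t + z t * deriv z t = 0 := by
  have hd := (((hr.hasDerivAt_deriv_of_two t).fun_pow 2).fun_add
    ((hy.hasDerivAt_deriv_of_two t).fun_pow 2)).fun_add ((hz.hasDerivAt_deriv_of_two t).fun_pow 2)
  rw [funext h] at hd
  have := hd.unique (hasDerivAt_const t (1 : ℝ))
  norm_num at this
  linarith

lemma sphere_acceleration_normal {r y z : ℝ → ℝ} (hr : ContDiff ℝ 2 r)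
    (hy : ContDiff ℝ 2 y) (hz : ContDiff ℝ 2 z)
    (h : ∀ t, r t ^ 2 + y t ^ 2 + z t ^ 2 = 1) (t : ℝ) :
    r t * deriv (deriv r) t + y t * deriv (deriv y) t + z t * deriv (deriv z) t =
      -(deriv r t ^ 2 + deriv y t ^ 2 + deriv z t ^ 2) := by
  have hd := (((hr.hasDerivAt_deriv_of_two t).fun_mul (hr.hasDerivAt_deriv_deriv t)).fun_add
    ((hy.hasDerivAt_deriv_of_two t).fun_mul (hy.hasDerivAt_deriv_deriv t))).fun_add
    ((hz.hasDerivAt_deriv_of_two t).fun_mul (hz.hasDerivAt_deriv_deriv t))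
  rw [funext (sphere_velocity_tangent hr hy hz h)] at hd
  have := hd.unique (hasDerivAt_const t (0 : ℝ))
  linarith

/-- On the sphere, the squared speed of the `(r, y, z)` part expressed through `y` and `z` only. -/
lemma sphere_speed_sq_eq {r y z r' y' z' : ℝ} (hr : 0 < r) (h : r ^ 2 + y ^ 2 + z ^ 2 = 1)
    (h' : r * r' + y * y' + z * z' = 0) :
    (y' ^ 2 + z' ^ 2 - (y * z' - z * y') ^ 2) / (1 - y ^ 2 - z ^ 2) =
      r' ^ 2 + y' ^ 2 + z' ^ 2 := by
  have hr2 : 1 - y ^ 2 - z ^ 2 = r ^ 2 := by linarith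
  rw [hr2, div_eq_iff (by positivity)]
  linear_combination (-(y' ^ 2 + z' ^ 2)) * h + (y * y' + z * z' - r * r') * h'

/-- The sum of an antisymmetric array over off-diagonal pairs vanishes. -/
lemma sum_sum_erase_eq_zero_of_antisymm {ι : Type*} [Fintype ι] [DecidableEq ι] (g : ι → ι → ℝ)
    (hg : ∀ i j, g i j = -g j i) : ∑ i, ∑ j ∈ univ.erase i, g i j = 0 := by
  have hdiag (i : ι) : g i i = 0 := by linarith [hg i i]
  have h : ∑ i, ∑ j, g i j = -∑ i, ∑ j, g i j := by
    conv_lhs => rw [sum_comm]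
    simp only [← sum_neg_distrib]
    exact sum_congr rfl fun i _ => sum_congr rfl fun j _ => hg j i
  simp only [sum_erase _ (hdiag _)]
  linarith

/-- Criterion for positive elliptic rotopulsators in S³. -/
theorem positive_elliptic_criterion
    (N : ℕ) (hN : 2 ≤ N)
    (m a : Fin N → ℝ) (hm : ∀ i, 0 < m i)
    (α : ℝ → ℝ) (r Y Z w x : Fin N → ℝ → ℝ)
    (hαC : ContDiff ℝ 2 α)
    (hrC : ∀ i, ContDiff ℝ 2 (r i))
    (hYC : ∀ i, ContDiff ℝ 2 (Y i))
    (hZC : ∀ i, ContDiff ℝ 2 (Z i))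
    (hw : ∀ i t, w i t = r i t * cos (α t + a i))
    (hx : ∀ i t, x i t = r i t * sin (α t + a i))
    (hrpos : ∀ i t, 0 < r i t) (hrle : ∀ i t, r i t ≤ 1)
    (hconstraint : ∀ i t, r i t ^ 2 + Y i t ^ 2 + Z i t ^ 2 = 1)
    (q : Fin N → Fin N → ℝ → ℝ)
    (hq : ∀ i j t, q i j t =
      w i t * w j t + x i t * x j t + Y i t * Y j t + Z i t * Z j t)
    (hreg : ∀ i j, i ≠ j → ∀ t, q i j t ^ 2 ≠ 1) :
    (∀ f : Fin N → ℝ → ℝ, (f = w ∨ f = x ∨ f = Y ∨ f = Z) → ∀ i t,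
        deriv (deriv (f i)) t =
          (∑ j ∈ Finset.univ.erase i,
            m j * (f j t - q i j t * f i t) / (1 - q i j t ^ 2) ^ ((3:ℝ)/2))
          - (deriv (w i) t ^ 2 + deriv (x i) t ^ 2 + deriv (Y i) t ^ 2
              + deriv (Z i) t ^ 2) * f i t)
    ↔
    (∃ c : ℝ,
      (∀ t, deriv α t = c / ∑ j, m j * r j t ^ 2) ∧
      (∀ i t,
        deriv (deriv (Y i)) t =
          (∑ j ∈ Finset.univ.erase i,
            m j * (Y j t - q i j t * Y i t) / (1 - q i j t ^ 2) ^ ((3:ℝ)/2))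
          - ((deriv (Y i) t ^ 2 + deriv (Z i) t ^ 2
                - (Y i t * deriv (Z i) t - Z i t * deriv (Y i) t) ^ 2)
              / (1 - Y i t ^ 2 - Z i t ^ 2)
             + c ^ 2 * (1 - Y i t ^ 2 - Z i t ^ 2)
              / (∑ j, m j * (1 - Y j t ^ 2 - Z j t ^ 2)) ^ 2) * Y i t) ∧
      (∀ i t,
        deriv (deriv (Z i)) t =
          (∑ j ∈ Finset.univ.erase i,
            m j * (Z j t - q i j t * Z i t) / (1 - q i j t ^ 2) ^ ((3:ℝ)/2))
          - ((deriv (Y i) t ^ 2 + deriv (Z i) t ^ 2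
                - (Y i t * deriv (Z i) t - Z i t * deriv (Y i) t) ^ 2)
              / (1 - Y i t ^ 2 - Z i t ^ 2)
             + c ^ 2 * (1 - Y i t ^ 2 - Z i t ^ 2)
              / (∑ j, m j * (1 - Y j t ^ 2 - Z j t ^ 2)) ^ 2) * Z i t) ∧
      (∀ i t,
        r i t * deriv (deriv α) t + 2 * deriv (r i) t * deriv α t =
          ∑ j ∈ Finset.univ.erase i,
            m j * r j t * sin (a j - a i) / (1 - q i j t ^ 2) ^ ((3:ℝ)/2))) := by
  have hw' (i : Fin N) : w i = fun t => r i t * cos (α t + a i) := funext (hw i)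
  have hx' (i : Fin N) : x i = fun t => r i t * sin (α t + a i) := funext (hx i)
  have hqcos (i j : Fin N) (t : ℝ) :
      q i j t = r i t * r j t * cos (a j - a i) + Y i t * Y j t + Z i t * Z j t := by
    rw [hq, hw, hw, hx, hx, show a j - a i = (α t + a j) - (α t + a i) by ring, cos_sub]
    ring
  have hqsymm (i j : Fin N) (t : ℝ) : q i j t = q j i t := by
    rw [hq, hq]; ring
  have hsumpos (t : ℝ) : 0 < ∑ j, m j * r j t ^ 2 :=
    sum_pos (fun j _ => mul_pos (hm j) (pow_pos (hrpos j t) 2)) ⟨⟨0, by omega⟩, mem_univ _⟩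
  have hr2 (i : Fin N) (t : ℝ) : 1 - Y i t ^ 2 - Z i t ^ 2 = r i t ^ 2 := by
    linarith [hconstraint i t]
  set A : Fin N → ℝ → ℝ := fun i t => ∑ j ∈ univ.erase i,
    m j * (r j t * cos (a j - a i) - q i j t * r i t) / (1 - q i j t ^ 2) ^ ((3 : ℝ) / 2) with hA
  set B : Fin N → ℝ → ℝ := fun i t => ∑ j ∈ univ.erase i,
    m j * r j t * sin (a j - a i) / (1 - q i j t ^ 2) ^ ((3 : ℝ) / 2) with hB
  have hangle (i j : Fin N) (t : ℝ) : α t + a j = (α t + a i) + (a j - a i) := by ring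
  have hforce_w (i : Fin N) (t : ℝ) : (∑ j ∈ univ.erase i,
      m j * (w j t - q i j t * w i t) / (1 - q i j t ^ 2) ^ ((3 : ℝ) / 2)) =
      A i t * cos (α t + a i) - B i t * sin (α t + a i) := by
    simp only [hA, hB, sum_mul, ← sum_sub_distrib]
    refine sum_congr rfl fun j _ => ?_
    rw [hw, hw, hangle i j t, cos_add]
    ring
  have hforce_x (i : Fin N) (t : ℝ) : (∑ j ∈ univ.erase i,
      m j * (x j t - q i j t * x i t) / (1 - q i j t ^ 2) ^ ((3 : ℝ) / 2)) =
      A i t * sin (α t + a i) + B i t * cos (α t + a i) := by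
    simp only [hA, hB, sum_mul, ← sum_add_distrib]
    refine sum_congr rfl fun j _ => ?_
    rw [hx, hx, hangle i j t, sin_add]
    ring
  have hforce_normal (i : Fin N) (t : ℝ) : r i t * A i t +
      Y i t * (∑ j ∈ univ.erase i,
        m j * (Y j t - q i j t * Y i t) / (1 - q i j t ^ 2) ^ ((3 : ℝ) / 2)) +
      Z i t * (∑ j ∈ univ.erase i,
        m j * (Z j t - q i j t * Z i t) / (1 - q i j t ^ 2) ^ ((3 : ℝ) / 2)) = 0 := by
    simp only [hA, mul_sum, ← sum_add_distrib]
    refine sum_eq_zero fun j _ => ?_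
    have : r i t * (r j t * cos (a j - a i) - q i j t * r i t) +
        Y i t * (Y j t - q i j t * Y i t) + Z i t * (Z j t - q i j t * Z i t) = 0 := by
      linear_combination -hqcos i j t - q i j t * hconstraint i t
    linear_combination m j / (1 - q i j t ^ 2) ^ ((3 : ℝ) / 2) * this
  have htorque (t : ℝ) : ∑ i, m i * r i t * B i t = 0 := by
    simp only [hB, mul_sum]
    refine sum_sum_erase_eq_zero_of_antisymm (fun i j => m i * r i t *
      (m j * r j t * sin (a j - a i) / (1 - q i j t ^ 2) ^ ((3 : ℝ) / 2))) fun i j => ?_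
    rw [hqsymm i j, ← neg_sub (a i) (a j), sin_neg]
    ring
  set V : Fin N → ℝ → ℝ := fun i t =>
    deriv (w i) t ^ 2 + deriv (x i) t ^ 2 + deriv (Y i) t ^ 2 + deriv (Z i) t ^ 2 with hV
  have hVeq (i : Fin N) (t : ℝ) : V i t =
      deriv (r i) t ^ 2 + deriv (Y i) t ^ 2 + deriv (Z i) t ^ 2 + r i t ^ 2 * deriv α t ^ 2 := by
    simp only [hV]
    rw [hw', hx', deriv_mul_cos_polar hαC (hrC i), deriv_mul_sin_polar hαC (hrC i)]
    linear_combination (deriv (r i) t ^ 2 + r i t ^ 2 * deriv α t ^ 2) *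
      sin_sq_add_cos_sq (α t + a i)
  have hF (c : ℝ) (hc : ∀ t, deriv α t = c / ∑ j, m j * r j t ^ 2) (i : Fin N) (t : ℝ) :
      (deriv (Y i) t ^ 2 + deriv (Z i) t ^ 2
          - (Y i t * deriv (Z i) t - Z i t * deriv (Y i) t) ^ 2) / (1 - Y i t ^ 2 - Z i t ^ 2)
        + c ^ 2 * (1 - Y i t ^ 2 - Z i t ^ 2)
          / (∑ j, m j * (1 - Y j t ^ 2 - Z j t ^ 2)) ^ 2 = V i t := by
    rw [sphere_speed_sq_eq (hrpos i t) (hconstraint i t)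
      (sphere_velocity_tangent (hrC i) (hYC i) (hZC i) (hconstraint i) t), hVeq, hc]
    simp only [hr2]
    ring
  have hplanar (i : Fin N) (t : ℝ) :
      (deriv (deriv (w i)) t = (∑ j ∈ univ.erase i,
          m j * (w j t - q i j t * w i t) / (1 - q i j t ^ 2) ^ ((3 : ℝ) / 2)) - V i t * w i t ∧
        deriv (deriv (x i)) t = (∑ j ∈ univ.erase i,
          m j * (x j t - q i j t * x i t) / (1 - q i j t ^ 2) ^ ((3 : ℝ) / 2)) - V i t * x i t) ↔
      deriv (deriv (r i)) t - r i t * deriv α t ^ 2 = A i t - V i t * r i t ∧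
        r i t * deriv (deriv α) t + 2 * deriv (r i) t * deriv α t = B i t := by
    rw [hforce_w, hforce_x, hw i t, hx i t, hw' i, hx' i,
      deriv_deriv_mul_cos_polar hαC (hrC i), deriv_deriv_mul_sin_polar hαC (hrC i)]
    refine Iff.trans ?_ (rotation_eq_iff (α t + a i) _ _ _ _)
    ring_nf
  constructor
  · intro h
    have hwx (i : Fin N) (t : ℝ) :=
      (hplanar i t).1 ⟨h w (.inl rfl) i t, h x (.inr (.inl rfl)) i t⟩
    have hmom (t : ℝ) : HasDerivAt (fun t => (∑ j, m j * r j t ^ 2) * deriv α t) 0 t := by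
      have hd := (HasDerivAt.fun_sum fun j (_ : j ∈ univ) =>
        (((hrC j).hasDerivAt_deriv_of_two t).fun_pow 2).const_mul (m j)).fun_mul
          (hαC.hasDerivAt_deriv_deriv t)
      refine hd.congr_deriv ?_
      rw [← htorque t, sum_mul, sum_mul, ← sum_add_distrib]
      refine sum_congr rfl fun i _ => ?_
      rw [← (hwx i t).2]
      norm_num
      ring
    have hconst := is_const_of_deriv_eq_zero (fun t => (hmom t).differentiableAt)
      fun t => (hmom t).deriv
    have hc (t : ℝ) :
        deriv α t = ((∑ j, m j * r j 0 ^ 2) * deriv α 0) / ∑ j, m j * r j t ^ 2 := by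
      rw [eq_div_iff (hsumpos t).ne', mul_comm]
      exact hconst t 0
    refine ⟨_, hc, fun i t => ?_, fun i t => ?_, fun i t => (hwx i t).2⟩
    · rw [hF _ hc]
      exact h Y (.inr (.inr (.inl rfl))) i t
    · rw [hF _ hc]
      exact h Z (.inr (.inr (.inr rfl))) i t
  · rintro ⟨c, hc, hY, hZ, htan⟩
    simp only [hF c hc] at hY hZ
    have hwx (i : Fin N) (t : ℝ) := (hplanar i t).2 ⟨by
      have hacc := sphere_acceleration_normal (hrC i) (hYC i) (hZC i) (hconstraint i) t
      rw [hY, hZ] at hacc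
      refine mul_left_cancel₀ (hrpos i t).ne' ?_
      linear_combination hacc - hforce_normal i t + hVeq i t + V i t * hconstraint i t,
      htan i t⟩
    rintro f (rfl | rfl | rfl | rfl) i t
    · exact (hwx i t).1
    · exact (hwx i t).2
    · exact hY i t
    · exact hZ i t
end

section
/- Let q = (q_1,…,q_N) be a solution of the curved N-body problem in S³ of positive elliptic-elliptic form with 0 < r_i(t) < 1, q_ij(t)² ≠ 1 for i ≠ j, and α̇ = c_1/(Σ_{j=1}^N m_j r_j²), β̇ = c_2/(M − Σ_{j=1}^N m_j r_j²) for constants c_1, c_2 ≠ 0, where M := Σ_i m_i. Then for all t: (a) the energy h(t) := Σ_{i=1}^N m_i ṙ_i²/(2(1 − r_i²)) + c_1²/(2 Σ_{j} m_j r_j²) + c_2²/(2(M − Σ_{j} m_j r_j²)) − Σ_{1≤i<j≤N} m_i m_j q_ij/(1 − q_ij²)^{1/2} is constant; (b) Σ_{i=1}^N m_i (w_i ẋ_i − ẇ_i x_i) = c_1; (c) Σ_{i=1}^N m_i (y_i ż_i − ẏ_i z_i) = c_2; (d) c_1/α̇ + c_2/β̇ = M. -/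
open Real Finset

theorem sum_erase_eq_sum_filter_lt {ι : Type*} [Fintype ι] [LinearOrder ι] (G : ι → ι → ℝ) :
    ∑ i, ∑ j ∈ univ.erase i, G i j = ∑ i, ∑ j ∈ univ.filter (fun j => i < j), (G i j + G j i) := by
  have hsplit : ∀ i, ∑ j ∈ univ.erase i, G i j =
      ∑ j ∈ univ.filter (fun j => i < j), G i j + ∑ j ∈ univ.filter (fun j => j < i), G i j := by
    intro i
    rw [← sum_union]
    · refine sum_congr ?_ fun _ _ => rfl
      ext j
      simp only [mem_erase, mem_univ, and_true, mem_union, mem_filter, true_and]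
      exact ne_comm.trans lt_or_lt_iff_ne.symm
    · refine disjoint_filter.2 fun j _ h => not_lt.2 h.le
  simp only [hsplit, sum_add_distrib]
  congr 1
  exact sum_comm' (by simp)

theorem rpow_three_halves_eq_sqrt_pow {s : ℝ} (hs : 0 ≤ s) : s ^ ((3 : ℝ) / 2) = √s ^ 3 := by
  rw [sqrt_eq_rpow, ← rpow_natCast, ← rpow_mul hs]
  norm_num

theorem hasDerivAt_div_sqrt_one_sub_sq {f : ℝ → ℝ} {f' t : ℝ} (hf : HasDerivAt f f' t)
    (h : 0 < 1 - f t ^ 2) :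
    HasDerivAt (fun s => f s / √(1 - f s ^ 2)) (f' / (1 - f t ^ 2) ^ ((3 : ℝ) / 2)) t := by
  have hs : 0 < √(1 - f t ^ 2) := sqrt_pos.2 h
  refine (hf.fun_div (((hf.fun_pow 2).const_sub 1).sqrt h.ne') hs.ne').congr_deriv ?_
  rw [rpow_three_halves_eq_sqrt_pow h.le]
  have hsq := sq_sqrt h.le
  field_simp
  rw [hsq]
  ring

/-- Conservation of energy for the curved `N`-body problem on the unit sphere of `E`. -/
theorem curved_nbody_energy_const {E ι : Type*} [NormedAddCommGroup E] [InnerProductSpace ℝ E]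
    [Fintype ι] [LinearOrder ι] (m : ι → ℝ) (p v : ι → ℝ → E)
    (hnorm : ∀ i t, ‖p i t‖ = 1)
    (hp : ∀ i t, HasDerivAt (p i) (v i t) t)
    (hreg : ∀ i j, i ≠ j → ∀ t, inner ℝ (p i t) (p j t) ^ 2 ≠ 1)
    (hv : ∀ i t, HasDerivAt (v i)
      ((∑ j ∈ univ.erase i, (m j / (1 - inner ℝ (p i t) (p j t) ^ 2) ^ ((3 : ℝ) / 2)) •
        (p j t - inner ℝ (p i t) (p j t) • p i t)) - ‖v i t‖ ^ 2 • p i t) t) :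
    ∃ h₀ : ℝ, ∀ t, ∑ i, m i / 2 * ‖v i t‖ ^ 2
      - ∑ i, ∑ j ∈ univ.filter (fun j => i < j),
          m i * m j * (inner ℝ (p i t) (p j t) / √(1 - inner ℝ (p i t) (p j t) ^ 2)) = h₀ := by
  have hpos : ∀ i j, i ≠ j → ∀ t, 0 < 1 - inner ℝ (p i t) (p j t) ^ 2 := by
    intro i j hij t
    have hle := abs_real_inner_le_norm (p i t) (p j t)
    rw [hnorm, hnorm, one_mul, ← sq_le_one_iff_abs_le_one] at hle
    exact sub_pos.2 (lt_of_le_of_ne hle (hreg i j hij t))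
  have horth : ∀ i t, inner ℝ (v i t) (p i t) = 0 := by
    intro i t
    have h1 := (hp i t).norm_sq
    simp only [hnorm] at h1
    have h2 := h1.unique (hasDerivAt_const t _)
    rw [real_inner_comm]
    linarith
  suffices h : ∀ t, HasDerivAt (fun t => ∑ i, m i / 2 * ‖v i t‖ ^ 2
      - ∑ i, ∑ j ∈ univ.filter (fun j => i < j),
          m i * m j * (inner ℝ (p i t) (p j t) / √(1 - inner ℝ (p i t) (p j t) ^ 2))) 0 t from
    ⟨_, fun t => is_const_of_deriv_eq_zero (fun t => (h t).differentiableAt)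
      (fun t => (h t).deriv) t 0⟩
  intro t
  have hK := HasDerivAt.fun_sum (u := univ) fun i _ => (hv i t).norm_sq.const_mul (m i / 2)
  have hU := HasDerivAt.fun_sum (u := univ) fun i _ =>
    HasDerivAt.fun_sum (u := univ.filter (fun j => i < j)) fun j hj =>
      (hasDerivAt_div_sqrt_one_sub_sq ((hp i t).inner ℝ (hp j t))
        (hpos i j (mem_filter.1 hj).2.ne t)).const_mul (m i * m j)
  refine (hK.sub hU).congr_deriv ?_
  have hkin : ∀ i, m i / 2 * (2 * inner ℝ (v i t)
      ((∑ j ∈ univ.erase i, (m j / (1 - inner ℝ (p i t) (p j t) ^ 2) ^ ((3 : ℝ) / 2)) •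
        (p j t - inner ℝ (p i t) (p j t) • p i t)) - ‖v i t‖ ^ 2 • p i t)) =
      ∑ j ∈ univ.erase i, m i * m j * (inner ℝ (v i t) (p j t) /
        (1 - inner ℝ (p i t) (p j t) ^ 2) ^ ((3 : ℝ) / 2)) := by
    intro i
    simp only [inner_sub_right, inner_sum, inner_smul_right, horth, mul_zero, sub_zero]
    rw [← mul_assoc, div_mul_cancel₀ _ two_ne_zero, mul_sum]
    exact sum_congr rfl fun j _ => by ring
  rw [sum_congr rfl fun i _ => hkin i, sum_erase_eq_sum_filter_lt, sub_eq_zero]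
  refine sum_congr rfl fun i _ => sum_congr rfl fun j _ => ?_
  rw [real_inner_comm (p j t) (p i t), real_inner_comm (v j t) (p i t)]
  ring

theorem hasDerivAt_euclideanSpace {κ : Type*} [Fintype κ] {f : ℝ → EuclideanSpace ℝ κ}
    {f' : EuclideanSpace ℝ κ} {t : ℝ} (h : ∀ k, HasDerivAt (fun s => f s k) (f' k) t) :
    HasDerivAt f f' t := by
  have hφ : HasDerivAt (fun s => (f s).ofLp) f'.ofLp t := hasDerivAt_pi.2 h
  exact (PiLp.hasFDerivAt_toLp (𝕜 := ℝ) (E := fun _ : κ => ℝ) 2 (f t).ofLp).comp_hasDerivAt t hφ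

theorem deriv_polar {s θ f g : ℝ → ℝ} {c : ℝ} (hs : Differentiable ℝ s) (hθ : Differentiable ℝ θ)
    (hf : ∀ t, f t = s t * cos (θ t + c)) (hg : ∀ t, g t = s t * sin (θ t + c)) (t : ℝ) :
    deriv f t ^ 2 + deriv g t ^ 2 = deriv s t ^ 2 + s t ^ 2 * deriv θ t ^ 2 ∧
      f t * deriv g t - deriv f t * g t = s t ^ 2 * deriv θ t := by
  have hθ' := (hθ t).hasDerivAt.add_const c
  have hf' := ((hs t).hasDerivAt.fun_mul hθ'.cos).deriv
  have hg' := ((hs t).hasDerivAt.fun_mul hθ'.sin).deriv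
  rw [← funext hf] at hf'
  rw [← funext hg] at hg'
  rw [hf', hg', hf, hg]
  have h1 := sin_sq_add_cos_sq (θ t + c)
  constructor
  · linear_combination (deriv s t ^ 2 + s t ^ 2 * deriv θ t ^ 2) * h1
  · linear_combination s t ^ 2 * deriv θ t * h1

theorem sq_deriv_add_sq_deriv_sqrt_one_sub_sq {r ρ : ℝ → ℝ} (hr : Differentiable ℝ r)
    (hρ : ∀ t, ρ t = √(1 - r t ^ 2)) {t : ℝ} (h : 0 < 1 - r t ^ 2) :
    deriv r t ^ 2 + deriv ρ t ^ 2 = deriv r t ^ 2 / (1 - r t ^ 2) := by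
  have hs : 0 < √(1 - r t ^ 2) := sqrt_pos.2 h
  have hd := ((((hr t).hasDerivAt.fun_pow 2).const_sub 1).sqrt h.ne').deriv
  rw [← funext hρ] at hd
  rw [hd, div_pow, mul_pow, sq_sqrt h.le]
  field_simp
  ring

/-- Conservation laws for positive elliptic-elliptic rotopulsators in S³. -/
theorem positive_elliptic_elliptic_conservation
    (N : ℕ) (hN : 2 ≤ N)
    (m a b : Fin N → ℝ) (hm : ∀ i, 0 < m i)
    (α β : ℝ → ℝ) (r ρ w x Y Z : Fin N → ℝ → ℝ)
    (hαC : ContDiff ℝ 2 α) (hβC : ContDiff ℝ 2 β)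
    (hrC : ∀ i, ContDiff ℝ 2 (r i))
    (hρ : ∀ i t, ρ i t = Real.sqrt (1 - r i t ^ 2))
    (hw : ∀ i t, w i t = r i t * cos (α t + a i))
    (hx : ∀ i t, x i t = r i t * sin (α t + a i))
    (hY : ∀ i t, Y i t = ρ i t * cos (β t + b i))
    (hZ : ∀ i t, Z i t = ρ i t * sin (β t + b i))
    (hrpos : ∀ i t, 0 < r i t) (hrlt : ∀ i t, r i t < 1)
    (q : Fin N → Fin N → ℝ → ℝ)
    (hq : ∀ i j t, q i j t =
      w i t * w j t + x i t * x j t + Y i t * Y j t + Z i t * Z j t)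
    (hreg : ∀ i j, i ≠ j → ∀ t, q i j t ^ 2 ≠ 1)
    (hsol : ∀ f : Fin N → ℝ → ℝ, (f = w ∨ f = x ∨ f = Y ∨ f = Z) → ∀ i t,
        deriv (deriv (f i)) t =
          (∑ j ∈ Finset.univ.erase i,
            m j * (f j t - q i j t * f i t) / (1 - q i j t ^ 2) ^ ((3:ℝ)/2))
          - (deriv (w i) t ^ 2 + deriv (x i) t ^ 2 + deriv (Y i) t ^ 2
              + deriv (Z i) t ^ 2) * f i t)
    (c₁ c₂ : ℝ) (hc₁ : c₁ ≠ 0) (hc₂ : c₂ ≠ 0)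
    (hαdot : ∀ t, deriv α t = c₁ / ∑ j, m j * r j t ^ 2)
    (hβdot : ∀ t, deriv β t = c₂ / ((∑ i, m i) - ∑ j, m j * r j t ^ 2)) :
    -- (a) the energy is constant
    (∃ h₀ : ℝ, ∀ t,
      (∑ i, m i * deriv (r i) t ^ 2 / (2 * (1 - r i t ^ 2)))
      + c₁ ^ 2 / (2 * ∑ j, m j * r j t ^ 2)
      + c₂ ^ 2 / (2 * ((∑ i, m i) - ∑ j, m j * r j t ^ 2))
      - (∑ i, ∑ j ∈ Finset.univ.filter (fun j => i < j),
          m i * m j * q i j t / Real.sqrt (1 - q i j t ^ 2)) = h₀) ∧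
    -- (b) angular momentum relative to the wx-plane
    (∀ t, ∑ i, m i * (w i t * deriv (x i) t - deriv (w i) t * x i t) = c₁) ∧
    -- (c) angular momentum relative to the yz-plane
    (∀ t, ∑ i, m i * (Y i t * deriv (Z i) t - deriv (Y i) t * Z i t) = c₂) ∧
    -- (d)
    (∀ t, c₁ / deriv α t + c₂ / deriv β t = ∑ i, m i) := by
  have hpos : ∀ i t, 0 < 1 - r i t ^ 2 := fun i t => by
    nlinarith [hrpos i t, hrlt i t]
  have hρsq : ∀ i t, ρ i t ^ 2 = 1 - r i t ^ 2 := fun i t => by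
    rw [hρ, sq_sqrt (hpos i t).le]
  have hρC : ∀ i, ContDiff ℝ 2 (ρ i) := fun i => by
    rw [funext (hρ i)]
    exact (contDiff_const.sub ((hrC i).pow 2)).sqrt fun t => (hpos i t).ne'
  have hwC : ∀ i, ContDiff ℝ 2 (w i) := fun i => by
    rw [funext (hw i)]
    exact (hrC i).mul (hαC.add contDiff_const).cos
  have hxC : ∀ i, ContDiff ℝ 2 (x i) := fun i => by
    rw [funext (hx i)]
    exact (hrC i).mul (hαC.add contDiff_const).sin
  have hYC : ∀ i, ContDiff ℝ 2 (Y i) := fun i => by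
    rw [funext (hY i)]
    exact (hρC i).mul (hβC.add contDiff_const).cos
  have hZC : ∀ i, ContDiff ℝ 2 (Z i) := fun i => by
    rw [funext (hZ i)]
    exact (hρC i).mul (hβC.add contDiff_const).sin
  have hrD : ∀ i, Differentiable ℝ (r i) := fun i => (hrC i).differentiable two_ne_zero
  have hwx := fun i => deriv_polar (hrD i) (hαC.differentiable two_ne_zero) (hw i) (hx i)
  have hYZ := fun i => deriv_polar ((hρC i).differentiable two_ne_zero)
    (hβC.differentiable two_ne_zero) (hY i) (hZ i)
  have hne : (univ : Finset (Fin N)).Nonempty := ⟨⟨0, by omega⟩, mem_univ _⟩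
  have hSpos : ∀ t, 0 < ∑ j, m j * r j t ^ 2 := fun t =>
    sum_pos (fun i _ => mul_pos (hm i) (pow_pos (hrpos i t) 2)) hne
  have hTeq : ∀ t, ∑ j, m j * ρ j t ^ 2 = (∑ i, m i) - ∑ j, m j * r j t ^ 2 := fun t => by
    simp only [hρsq, mul_sub, mul_one, sum_sub_distrib]
  have hTpos : ∀ t, 0 < (∑ i, m i) - ∑ j, m j * r j t ^ 2 := fun t => by
    rw [← hTeq]
    exact sum_pos (fun i _ => mul_pos (hm i) (by rw [hρsq]; exact hpos i t)) hne
  refine ⟨?_, fun t => ?_, fun t => ?_, fun t => ?_⟩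
  · let p : Fin N → ℝ → EuclideanSpace ℝ (Fin 4) := fun i t => !₂[w i t, x i t, Y i t, Z i t]
    let v : Fin N → ℝ → EuclideanSpace ℝ (Fin 4) := fun i t =>
      !₂[deriv (w i) t, deriv (x i) t, deriv (Y i) t, deriv (Z i) t]
    have hinner : ∀ i j t, inner ℝ (p i t) (p j t) = q i j t := fun i j t => by
      simp only [p, hq, PiLp.inner_apply, Fin.sum_univ_four]
      simp
      ring
    have hvsq : ∀ i t, ‖v i t‖ ^ 2 = deriv (w i) t ^ 2 + deriv (x i) t ^ 2 + deriv (Y i) t ^ 2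
        + deriv (Z i) t ^ 2 := fun i t => by
      simp [v, EuclideanSpace.norm_sq_eq, Fin.sum_univ_four]
    have hqself : ∀ i t, q i i t = 1 := fun i t => by
      rw [hq, hw, hx, hY, hZ]
      linear_combination r i t ^ 2 * sin_sq_add_cos_sq (α t + a i)
        + ρ i t ^ 2 * sin_sq_add_cos_sq (β t + b i) + hρsq i t
    have hD : ∀ {f : ℝ → ℝ}, ContDiff ℝ 2 f → ∀ t, HasDerivAt f (deriv f t) t := fun hf t =>
      (hf.differentiable two_ne_zero t).hasDerivAt
    have hD2 : ∀ {f : ℝ → ℝ}, ContDiff ℝ 2 f → ∀ t,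
        HasDerivAt (deriv f) (deriv (deriv f) t) t := fun hf t =>
      (hf.differentiable_deriv_two t).hasDerivAt
    obtain ⟨h₀, hh⟩ := curved_nbody_energy_const m p v
      (fun i t => by
        rw [← sq_eq_sq₀ (norm_nonneg _) zero_le_one, ← real_inner_self_eq_norm_sq, hinner,
          hqself, one_pow])
      (fun i t => hasDerivAt_euclideanSpace fun k => by
        fin_cases k
        exacts [hD (hwC i) t, hD (hxC i) t, hD (hYC i) t, hD (hZC i) t])
      (fun i j hij t => by rw [hinner]; exact hreg i j hij t)
      (fun i t => hasDerivAt_euclideanSpace fun k => by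
        simp only [hinner, hvsq, PiLp.sub_apply, WithLp.ofLp_sum, Finset.sum_apply,
          PiLp.smul_apply, smul_eq_mul, div_mul_eq_mul_div]
        fin_cases k
        · exact (hD2 (hwC i) t).congr_deriv (hsol w (by simp) i t)
        · exact (hD2 (hxC i) t).congr_deriv (hsol x (by simp) i t)
        · exact (hD2 (hYC i) t).congr_deriv (hsol Y (by simp) i t)
        · exact (hD2 (hZC i) t).congr_deriv (hsol Z (by simp) i t))
    refine ⟨h₀, fun t => (hh t).symm ▸ ?_⟩
    simp only [hinner, ← mul_div_assoc]
    congr 1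
    have hterm : ∀ i, m i / 2 * ‖v i t‖ ^ 2 = m i * deriv (r i) t ^ 2 / (2 * (1 - r i t ^ 2))
        + (m i * r i t ^ 2) * (deriv α t ^ 2 / 2) + (m i * ρ i t ^ 2) * (deriv β t ^ 2 / 2) := by
      intro i
      have hr := sq_deriv_add_sq_deriv_sqrt_one_sub_sq (hrD i) (hρ i) (hpos i t)
      rw [hvsq, mul_comm 2 (1 - r i t ^ 2), ← div_div, mul_div_assoc, ← hr]
      linear_combination m i / 2 * ((hwx i t).1 + (hYZ i t).1)
    simp only [hterm, sum_add_distrib, ← sum_mul]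
    rw [hTeq, hαdot, hβdot]
    have h1 := (hSpos t).ne'
    have h2 := (hTpos t).ne'
    field_simp
  · simp only [(hwx _ t).2, ← mul_assoc, ← sum_mul]
    rw [hαdot, mul_div_cancel₀ _ (hSpos t).ne']
  · simp only [(hYZ _ t).2, ← mul_assoc, ← sum_mul]
    rw [hTeq, hβdot, mul_div_cancel₀ _ (hTpos t).ne']
  · rw [hαdot, hβdot, div_div_cancel₀ hc₁, div_div_cancel₀ hc₂, add_sub_cancel]
end

section
/- Let q = (q_1,…,q_N) be a solution of the curved N-body problem in S³ of positive elliptic-elliptic form (this includes the positive elliptic case, obtained by taking β constant). Suppose each body is confined to a Clifford torus: for each i there are constants r^i, ρ^i ≥ 0 with (r^i)² + (ρ^i)² = 1 such that w_i(t)² + x_i(t)² = (r^i)² and y_i(t)² + z_i(t)² = (ρ^i)² for all t. Then every mutual inner product q_ij := q_i · q_j is constant in t, i.e., the solution is a relative equilibrium. Consequently, if q is a rotopulsator (some q_ij with i ≠ j is nonconstant), then for any foliation of S³ by Clifford tori at least one body's trajectory is not contained in a single Clifford torus. -/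
open Real Finset

/-- For two points in polar form, the planar inner product does not depend on
the common phase. -/
lemma mul_cos_sin_inner_eq (r₁ r₂ θ c d : ℝ) :
    r₁ * cos (θ + c) * (r₂ * cos (θ + d)) + r₁ * sin (θ + c) * (r₂ * sin (θ + d)) =
      r₁ * r₂ * cos (c - d) := by
  rw [show c - d = (θ + c) - (θ + d) by ring, cos_sub]
  ring

/-- If every body of a positive elliptic-elliptic solution in S³ is confined to
a Clifford torus, then all mutual inner products are constant (the solution is
a relative equilibrium); hence a rotopulsator has at least one body whose
trajectory meets a continuum of Clifford tori. -/
theorem clifford_tori_confinement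
    (N : ℕ) (hN : 2 ≤ N)
    (m a b : Fin N → ℝ) (hm : ∀ i, 0 < m i)
    (α β : ℝ → ℝ) (r ρ w x Y Z : Fin N → ℝ → ℝ)
    (hαC : ContDiff ℝ 2 α) (hβC : ContDiff ℝ 2 β)
    (hrC : ∀ i, ContDiff ℝ 2 (r i))
    (hρ : ∀ i t, ρ i t = Real.sqrt (1 - r i t ^ 2))
    (hr0 : ∀ i t, 0 ≤ r i t) (hr1 : ∀ i t, r i t ≤ 1)
    (hw : ∀ i t, w i t = r i t * cos (α t + a i))
    (hx : ∀ i t, x i t = r i t * sin (α t + a i))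
    (hY : ∀ i t, Y i t = ρ i t * cos (β t + b i))
    (hZ : ∀ i t, Z i t = ρ i t * sin (β t + b i))
    (q : Fin N → Fin N → ℝ → ℝ)
    (hq : ∀ i j t, q i j t =
      w i t * w j t + x i t * x j t + Y i t * Y j t + Z i t * Z j t)
    (hreg : ∀ i j, i ≠ j → ∀ t, q i j t ^ 2 ≠ 1)
    -- q solves the equations of motion in S³
    (hsol : ∀ f : Fin N → ℝ → ℝ, (f = w ∨ f = x ∨ f = Y ∨ f = Z) → ∀ i t,
        deriv (deriv (f i)) t =
          (∑ j ∈ Finset.univ.erase i,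
            m j * (f j t - q i j t * f i t) / (1 - q i j t ^ 2) ^ ((3:ℝ)/2))
          - (deriv (w i) t ^ 2 + deriv (x i) t ^ 2 + deriv (Y i) t ^ 2
              + deriv (Z i) t ^ 2) * f i t)
    -- each body is confined to a Clifford torus
    (hconf : ∀ i, ∃ R P : ℝ, 0 ≤ R ∧ 0 ≤ P ∧ R ^ 2 + P ^ 2 = 1 ∧
      ∀ t, w i t ^ 2 + x i t ^ 2 = R ^ 2 ∧ Y i t ^ 2 + Z i t ^ 2 = P ^ 2) :
    -- then every mutual inner product is constant: the solution is a
    -- relative equilibrium (so it is not a rotopulsator)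
    ∀ i j, ∀ t₁ t₂, q i j t₁ = q i j t₂ := by
  have hr_const : ∀ i t₁ t₂, r i t₁ = r i t₂ := by
    intro i t₁ t₂
    obtain ⟨R, P, hR, -, -, h⟩ := hconf i
    have hrR : ∀ t, r i t = R := by
      intro t
      have hsq : r i t ^ 2 = R ^ 2 := by
        rw [← (h t).1, hw, hx]
        linear_combination -(r i t ^ 2) * sin_sq_add_cos_sq (α t + a i)
      exact (pow_left_inj₀ (hr0 i t) hR two_ne_zero).mp hsq
    rw [hrR, hrR]
  have hq_eq : ∀ i j t, q i j t =
      r i t * r j t * cos (a i - a j) + ρ i t * ρ j t * cos (b i - b j) := by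
    intro i j t
    rw [hq, hw, hw, hx, hx, hY, hY, hZ, hZ, ← mul_cos_sin_inner_eq _ _ (α t),
      ← mul_cos_sin_inner_eq _ _ (β t)]
    ring
  intro i j t₁ t₂
  simp only [hq_eq, hρ, hr_const _ t₁ t₂]
end

section
/- Let N ≥ 2, let m_1,…,m_N > 0, and let q = (q_1,…,q_N) be a candidate solution of the curved N-body problem in H³ of negative elliptic form, with r_i(t) > 0 for all i, t and q_ij(t)² ≠ 1 for i ≠ j. Then q solves the equations of motion in H³ if and only if there exists a constant b such that α̇ = b/(Σ_{j=1}^N m_j r_j²), and for every i = 1,…,N and every t: (1) ÿ_i = Σ_{j≠i} m_j (y_j + q_ij y_i)/(q_ij² − 1)^{3/2} + H_i y_i; (2) z̈_i = Σ_{j≠i} m_j (z_j + q_ij z_i)/(q_ij² − 1)^{3/2} + H_i z_i; (3) r_i α̈ + 2 ṙ_i α̇ = Σ_{j≠i} m_j r_j sin(a_j − a_i)/(q_ij² − 1)^{3/2}; where H_i := [(y_i ż_i − z_i ẏ_i)² + ż_i² − ẏ_i²]/(z_i² − y_i² − 1) + b² (z_i² − y_i² − 1)/[Σ_{j=1}^N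 m_j (z_j² − y_j² − 1)]². -/
open Real Finset

/-- A `C²` function has a derivative everywhere, and so does its derivative. -/
lemma hasDerivAt_deriv_of_contDiff_two {f : ℝ → ℝ} (hf : ContDiff ℝ 2 f) (t : ℝ) :
    HasDerivAt f (deriv f t) t ∧ HasDerivAt (deriv f) (deriv (deriv f) t) t := by
  have h : ContDiff ℝ (1 + 1) f := by norm_num; exact hf
  have h1 := (contDiff_succ_iff_deriv.1 h).2.2
  exact ⟨(hf.differentiable (by norm_num) t).hasDerivAt,
    (h1.differentiable (by norm_num) t).hasDerivAt⟩

/-- First two derivatives of `ρ cos (α + a)`. -/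
lemma deriv_mul_cos {f ρ α : ℝ → ℝ} {a : ℝ} (hρ : ContDiff ℝ 2 ρ) (hα : ContDiff ℝ 2 α)
    (hf : ∀ t, f t = ρ t * cos (α t + a)) :
    (∀ t, deriv f t =
      deriv ρ t * cos (α t + a) - ρ t * deriv α t * sin (α t + a)) ∧
    (∀ t, deriv (deriv f) t =
      (deriv (deriv ρ) t - ρ t * deriv α t ^ 2) * cos (α t + a)
        - (ρ t * deriv (deriv α) t + 2 * deriv ρ t * deriv α t) * sin (α t + a)) := by
  have h1 : ∀ t, deriv f t =
      deriv ρ t * cos (α t + a) - ρ t * deriv α t * sin (α t + a) := fun t => by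
    have hr := (hasDerivAt_deriv_of_contDiff_two hρ t).1
    have ha := ((hasDerivAt_deriv_of_contDiff_two hα t).1).add_const a
    rw [funext hf, (hr.fun_mul ha.cos).deriv]
    ring
  refine ⟨h1, fun t => ?_⟩
  obtain ⟨hr, hr'⟩ := hasDerivAt_deriv_of_contDiff_two hρ t
  obtain ⟨ha, ha'⟩ := hasDerivAt_deriv_of_contDiff_two hα t
  rw [funext h1,
    ((hr'.fun_mul (ha.add_const a).cos).fun_sub
      ((hr.fun_mul ha').fun_mul (ha.add_const a).sin)).deriv]
  ring

/-- First two derivatives of `ρ sin (α + a)`. -/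
lemma deriv_mul_sin {f ρ α : ℝ → ℝ} {a : ℝ} (hρ : ContDiff ℝ 2 ρ) (hα : ContDiff ℝ 2 α)
    (hf : ∀ t, f t = ρ t * sin (α t + a)) :
    (∀ t, deriv f t =
      deriv ρ t * sin (α t + a) + ρ t * deriv α t * cos (α t + a)) ∧
    (∀ t, deriv (deriv f) t =
      (deriv (deriv ρ) t - ρ t * deriv α t ^ 2) * sin (α t + a)
        + (ρ t * deriv (deriv α) t + 2 * deriv ρ t * deriv α t) * cos (α t + a)) := by
  have h1 : ∀ t, deriv f t =
      deriv ρ t * sin (α t + a) + ρ t * deriv α t * cos (α t + a) := fun t => by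
    have hr := (hasDerivAt_deriv_of_contDiff_two hρ t).1
    have ha := ((hasDerivAt_deriv_of_contDiff_two hα t).1).add_const a
    rw [funext hf, (hr.fun_mul ha.sin).deriv]
    ring
  refine ⟨h1, fun t => ?_⟩
  obtain ⟨hr, hr'⟩ := hasDerivAt_deriv_of_contDiff_two hρ t
  obtain ⟨ha, ha'⟩ := hasDerivAt_deriv_of_contDiff_two hα t
  rw [funext h1,
    ((hr'.fun_mul (ha.add_const a).sin).fun_add
      ((hr.fun_mul ha').fun_mul (ha.add_const a).cos)).deriv]
  ring

/-- The first and second derivatives of the constraint `ρ² + y² - z² = -1`. -/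
lemma deriv_hyperboloid {ρ y z : ℝ → ℝ} (hρ : ContDiff ℝ 2 ρ) (hy : ContDiff ℝ 2 y)
    (hz : ContDiff ℝ 2 z) (h : ∀ t, ρ t ^ 2 + y t ^ 2 - z t ^ 2 = -1) :
    (∀ t, ρ t * deriv ρ t + y t * deriv y t - z t * deriv z t = 0) ∧
    (∀ t, deriv ρ t ^ 2 + ρ t * deriv (deriv ρ) t + deriv y t ^ 2 + y t * deriv (deriv y) t
      - deriv z t ^ 2 - z t * deriv (deriv z) t = 0) := by
  have h1 : ∀ t, ρ t * deriv ρ t + y t * deriv y t - z t * deriv z t = 0 := fun t => by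
    have hd := (((hasDerivAt_deriv_of_contDiff_two hρ t).1.fun_pow 2).fun_add
      ((hasDerivAt_deriv_of_contDiff_two hy t).1.fun_pow 2)).fun_sub
      ((hasDerivAt_deriv_of_contDiff_two hz t).1.fun_pow 2)
    rw [funext h] at hd
    have := hd.unique (hasDerivAt_const t (-1))
    norm_num at this
    linarith
  refine ⟨h1, fun t => ?_⟩
  obtain ⟨a, a'⟩ := hasDerivAt_deriv_of_contDiff_two hρ t
  obtain ⟨b, b'⟩ := hasDerivAt_deriv_of_contDiff_two hy t
  obtain ⟨c, c'⟩ := hasDerivAt_deriv_of_contDiff_two hz t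
  have hd := ((a.fun_mul a').fun_add (b.fun_mul b')).fun_sub (c.fun_mul c')
  rw [funext h1] at hd
  have := hd.unique (hasDerivAt_const t 0)
  linarith

/-- The Lorentz square of the velocity of a point of elliptic form, with its radius eliminated. -/
lemma lorentz_speed_sq {ρ ρ' y y' z z' c s A : ℝ} (hρ : ρ ≠ 0)
    (hcs : s ^ 2 + c ^ 2 = 1) (h : ρ ^ 2 + y ^ 2 - z ^ 2 = -1)
    (h' : ρ * ρ' + y * y' - z * z' = 0) :
    (ρ' * c - ρ * A * s) ^ 2 + (ρ' * s + ρ * A * c) ^ 2 + y' ^ 2 - z' ^ 2 =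
      ((y * z' - z * y') ^ 2 + z' ^ 2 - y' ^ 2) / (z ^ 2 - y ^ 2 - 1) + ρ ^ 2 * A ^ 2 := by
  have e : z ^ 2 - y ^ 2 - 1 = ρ ^ 2 := by linarith
  have e1 : (y * z' - z * y') ^ 2 + z' ^ 2 - y' ^ 2 = (ρ' ^ 2 + y' ^ 2 - z' ^ 2) * ρ ^ 2 := by
    have e2 : ρ * ρ' = z * z' - y * y' := by linarith
    linear_combination (-(ρ * ρ') - (z * z' - y * y')) * e2 - (z' ^ 2 - y' ^ 2) * e
  rw [e, e1, mul_div_cancel_right₀ _ (pow_ne_zero 2 hρ)]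
  linear_combination (ρ' ^ 2 + ρ ^ 2 * A ^ 2) * hcs

/-- The tangential component of the attraction exerted on a point of elliptic form. -/
lemma tangential_force {ι : Type*} (S : Finset ι) (i : ι) (m a ρ w x q D : ι → ℝ) (θ : ℝ)
    (hw : ∀ j, w j = ρ j * cos (θ + a j)) (hx : ∀ j, x j = ρ j * sin (θ + a j)) :
    cos (θ + a i) * (∑ j ∈ S, m j * (x j + q j * x i) / D j)
      - sin (θ + a i) * (∑ j ∈ S, m j * (w j + q j * w i) / D j) =
      ∑ j ∈ S, m j * ρ j * sin (a j - a i) / D j := by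
  rw [mul_sum, mul_sum, ← sum_sub_distrib]
  refine sum_congr rfl fun j _ => ?_
  have : sin (a j - a i) =
      sin (θ + a j) * cos (θ + a i) - cos (θ + a j) * sin (θ + a i) := by
    rw [← sin_sub]; ring_nf
  rw [this, hw, hx, hw, hx]
  ring

/-- The attraction exerted on a point of the hyperboloid is tangent to it. -/
lemma force_lorentz_orthogonal {ι : Type*} (S : Finset ι) (i : ι) (m w x y z q D : ι → ℝ)
    (hq : ∀ j, q j = w i * w j + x i * x j + y i * y j - z i * z j)
    (h : w i ^ 2 + x i ^ 2 + y i ^ 2 - z i ^ 2 = -1) :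
    w i * (∑ j ∈ S, m j * (w j + q j * w i) / D j)
      + x i * (∑ j ∈ S, m j * (x j + q j * x i) / D j)
      + y i * (∑ j ∈ S, m j * (y j + q j * y i) / D j)
      - z i * (∑ j ∈ S, m j * (z j + q j * z i) / D j) = 0 := by
  simp only [mul_sum, ← sum_add_distrib, ← sum_sub_distrib]
  refine sum_eq_zero fun j _ => ?_
  linear_combination (m j / D j) * (q j * h - hq j)

/-- The total moment of the tangential attractions vanishes. -/
lemma sum_torque_eq_zero {ι : Type*} [Fintype ι] [DecidableEq ι] (m a ρ : ι → ℝ)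
    (D : ι → ι → ℝ) (hD : ∀ i j, D i j = D j i) :
    ∑ i, m i * ρ i * ∑ j ∈ univ.erase i, m j * ρ j * sin (a j - a i) / D i j = 0 := by
  have h1 : ∀ i, ∑ j ∈ univ.erase i, m j * ρ j * sin (a j - a i) / D i j =
      ∑ j, m j * ρ j * sin (a j - a i) / D i j := fun i =>
    sum_erase _ (by simp)
  simp only [h1, mul_sum]
  have h2 : ∑ i, ∑ j, m i * ρ i * (m j * ρ j * sin (a j - a i) / D i j) =
      -∑ i, ∑ j, m i * ρ i * (m j * ρ j * sin (a j - a i) / D i j) := by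
    conv_lhs => rw [sum_comm]
    simp only [← sum_neg_distrib]
    refine sum_congr rfl fun i _ => sum_congr rfl fun j _ => ?_
    rw [hD j i, ← neg_sub (a j) (a i), sin_neg]
    ring
  linarith

/-- If no torque acts, the angular velocity is a constant over the moment of inertia. -/
lemma exists_angular_velocity_eq {ι : Type*} [Fintype ι] [Nonempty ι] (m : ι → ℝ)
    (hm : ∀ i, 0 < m i) (α : ℝ → ℝ) (ρ : ι → ℝ → ℝ) (hα : ContDiff ℝ 2 α)
    (hρ : ∀ i, ContDiff ℝ 2 (ρ i)) (hpos : ∀ i t, 0 < ρ i t)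
    (h : ∀ t, ∑ i, m i * ρ i t *
      (ρ i t * deriv (deriv α) t + 2 * deriv (ρ i) t * deriv α t) = 0) :
    ∃ b : ℝ, ∀ t, deriv α t = b / ∑ j, m j * ρ j t ^ 2 := by
  have hd : ∀ t, HasDerivAt (fun t => deriv α t * ∑ j, m j * ρ j t ^ 2) 0 t := fun t => by
    have h1 : HasDerivAt (fun t => ∑ j, m j * ρ j t ^ 2)
        (∑ j, m j * (2 * ρ j t * deriv (ρ j) t)) t := by
      refine HasDerivAt.fun_sum fun j _ => ?_
      have := ((hasDerivAt_deriv_of_contDiff_two (hρ j) t).1.fun_pow 2).const_mul (m j)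
      norm_num at this
      exact this
    have h2 := (hasDerivAt_deriv_of_contDiff_two hα t).2.fun_mul h1
    refine h2.congr_deriv ?_
    rw [← h t, mul_sum, mul_sum, ← sum_add_distrib]
    exact sum_congr rfl fun j _ => by ring
  have hc := is_const_of_deriv_eq_zero (fun t => (hd t).differentiableAt) fun t => (hd t).deriv
  refine ⟨deriv α 0 * ∑ j, m j * ρ j 0 ^ 2, fun t => ?_⟩
  have : 0 < ∑ j, m j * ρ j t ^ 2 :=
    sum_pos (fun j _ => mul_pos (hm j) (pow_pos (hpos j t) 2)) univ_nonempty
  rw [eq_div_iff this.ne']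
  exact hc t 0

/-- Criterion for negative elliptic rotopulsators in H³. -/
theorem negative_elliptic_criterion
    (N : ℕ) (hN : 2 ≤ N)
    (m a : Fin N → ℝ) (hm : ∀ i, 0 < m i)
    (α : ℝ → ℝ) (r Y Z w x : Fin N → ℝ → ℝ)
    (hαC : ContDiff ℝ 2 α)
    (hrC : ∀ i, ContDiff ℝ 2 (r i))
    (hYC : ∀ i, ContDiff ℝ 2 (Y i))
    (hZC : ∀ i, ContDiff ℝ 2 (Z i))
    (hw : ∀ i t, w i t = r i t * cos (α t + a i))
    (hx : ∀ i t, x i t = r i t * sin (α t + a i))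
    (hrpos : ∀ i t, 0 < r i t)
    (hz1 : ∀ i t, 1 ≤ Z i t)
    (hconstraint : ∀ i t, r i t ^ 2 + Y i t ^ 2 - Z i t ^ 2 = -1)
    (q : Fin N → Fin N → ℝ → ℝ)
    (hq : ∀ i j t, q i j t =
      w i t * w j t + x i t * x j t + Y i t * Y j t - Z i t * Z j t)
    (hreg : ∀ i j, i ≠ j → ∀ t, q i j t ^ 2 ≠ 1) :
    (∀ f : Fin N → ℝ → ℝ, (f = w ∨ f = x ∨ f = Y ∨ f = Z) → ∀ i t,
        deriv (deriv (f i)) t =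
          (∑ j ∈ Finset.univ.erase i,
            m j * (f j t + q i j t * f i t) / (q i j t ^ 2 - 1) ^ ((3:ℝ)/2))
          + (deriv (w i) t ^ 2 + deriv (x i) t ^ 2 + deriv (Y i) t ^ 2
              - deriv (Z i) t ^ 2) * f i t)
    ↔
    (∃ b : ℝ,
      (∀ t, deriv α t = b / ∑ j, m j * r j t ^ 2) ∧
      (∀ i t,
        deriv (deriv (Y i)) t =
          (∑ j ∈ Finset.univ.erase i,
            m j * (Y j t + q i j t * Y i t) / (q i j t ^ 2 - 1) ^ ((3:ℝ)/2))
          + (((Y i t * deriv (Z i) t - Z i t * deriv (Y i) t) ^ 2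
                + deriv (Z i) t ^ 2 - deriv (Y i) t ^ 2)
              / (Z i t ^ 2 - Y i t ^ 2 - 1)
             + b ^ 2 * (Z i t ^ 2 - Y i t ^ 2 - 1)
              / (∑ j, m j * (Z j t ^ 2 - Y j t ^ 2 - 1)) ^ 2) * Y i t) ∧
      (∀ i t,
        deriv (deriv (Z i)) t =
          (∑ j ∈ Finset.univ.erase i,
            m j * (Z j t + q i j t * Z i t) / (q i j t ^ 2 - 1) ^ ((3:ℝ)/2))
          + (((Y i t * deriv (Z i) t - Z i t * deriv (Y i) t) ^ 2
                + deriv (Z i) t ^ 2 - deriv (Y i) t ^ 2)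
              / (Z i t ^ 2 - Y i t ^ 2 - 1)
             + b ^ 2 * (Z i t ^ 2 - Y i t ^ 2 - 1)
              / (∑ j, m j * (Z j t ^ 2 - Y j t ^ 2 - 1)) ^ 2) * Z i t) ∧
      (∀ i t,
        r i t * deriv (deriv α) t + 2 * deriv (r i) t * deriv α t =
          ∑ j ∈ Finset.univ.erase i,
            m j * r j t * sin (a j - a i) / (q i j t ^ 2 - 1) ^ ((3:ℝ)/2))) := by
  have : Nonempty (Fin N) := ⟨⟨0, by omega⟩⟩
  have hw1 := fun i => (deriv_mul_cos (hrC i) hαC (hw i)).1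
  have hw2 := fun i => (deriv_mul_cos (hrC i) hαC (hw i)).2
  have hx1 := fun i => (deriv_mul_sin (hrC i) hαC (hx i)).1
  have hx2 := fun i => (deriv_mul_sin (hrC i) hαC (hx i)).2
  have htan := fun i t =>
    tangential_force (univ.erase i) i m a (fun j => r j t) (fun j => w j t) (fun j => x j t)
      (fun j => q i j t) (fun j => (q i j t ^ 2 - 1) ^ ((3:ℝ)/2)) (α t)
      (fun j => hw j t) (fun j => hx j t)
  have hcs : ∀ i t, sin (α t + a i) ^ 2 + cos (α t + a i) ^ 2 = 1 :=
    fun i t => sin_sq_add_cos_sq _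
  have hspeed : ∀ b : ℝ, (∀ t, deriv α t = b / ∑ j, m j * r j t ^ 2) → ∀ i t,
      deriv (w i) t ^ 2 + deriv (x i) t ^ 2 + deriv (Y i) t ^ 2 - deriv (Z i) t ^ 2 =
        ((Y i t * deriv (Z i) t - Z i t * deriv (Y i) t) ^ 2
            + deriv (Z i) t ^ 2 - deriv (Y i) t ^ 2) / (Z i t ^ 2 - Y i t ^ 2 - 1)
          + b ^ 2 * (Z i t ^ 2 - Y i t ^ 2 - 1)
            / (∑ j, m j * (Z j t ^ 2 - Y j t ^ 2 - 1)) ^ 2 := fun b hb i t => by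
    have e : ∀ j, Z j t ^ 2 - Y j t ^ 2 - 1 = r j t ^ 2 := fun j => by
      linarith [hconstraint j t]
    rw [hw1, hx1, lorentz_speed_sq (hrpos i t).ne' (hcs i t) (hconstraint i t)
      ((deriv_hyperboloid (hrC i) (hYC i) (hZC i) (hconstraint i)).1 t), hb t]
    simp only [e]
    ring
  constructor
  · intro H
    have h3 : ∀ i t, r i t * deriv (deriv α) t + 2 * deriv (r i) t * deriv α t =
        ∑ j ∈ univ.erase i,
          m j * r j t * sin (a j - a i) / (q i j t ^ 2 - 1) ^ ((3:ℝ)/2) := fun i t => by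
      have Hw := H w (by simp) i t
      have Hx := H x (by simp) i t
      rw [hw2] at Hw
      rw [hx2] at Hx
      rw [← htan i t]
      set K := deriv (w i) t ^ 2 + deriv (x i) t ^ 2 + deriv (Y i) t ^ 2 - deriv (Z i) t ^ 2
      linear_combination cos (α t + a i) * Hx - sin (α t + a i) * Hw
        - (r i t * deriv (deriv α) t + 2 * deriv (r i) t * deriv α t) * hcs i t
        + K * cos (α t + a i) * hx i t - K * sin (α t + a i) * hw i t
    obtain ⟨b, hb⟩ := exists_angular_velocity_eq m hm α r hαC hrC hrpos fun t => by
      simp only [h3]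
      exact sum_torque_eq_zero m a (fun j => r j t)
        (fun i j => (q i j t ^ 2 - 1) ^ ((3:ℝ)/2)) fun i j => by
          have : q i j t = q j i t := by rw [hq, hq]; ring
          rw [this]
    refine ⟨b, hb, fun i t => ?_, fun i t => ?_, h3⟩
    · rw [← hspeed b hb i t]
      exact H Y (by simp) i t
    · rw [← hspeed b hb i t]
      exact H Z (by simp) i t
  · rintro ⟨b, hb, hY, hZ, h3⟩
    simp only [← hspeed b hb] at hY hZ
    have hwx : ∀ i t,
        deriv (deriv (w i)) t = (∑ j ∈ univ.erase i,
            m j * (w j t + q i j t * w i t) / (q i j t ^ 2 - 1) ^ ((3:ℝ)/2))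
          + (deriv (w i) t ^ 2 + deriv (x i) t ^ 2 + deriv (Y i) t ^ 2
              - deriv (Z i) t ^ 2) * w i t ∧
        deriv (deriv (x i)) t = (∑ j ∈ univ.erase i,
            m j * (x j t + q i j t * x i t) / (q i j t ^ 2 - 1) ^ ((3:ℝ)/2))
          + (deriv (w i) t ^ 2 + deriv (x i) t ^ 2 + deriv (Y i) t ^ 2
              - deriv (Z i) t ^ 2) * x i t := fun i t => by
      have hy := hY i t
      have hz := hZ i t
      have ht := htan i t
      rw [← h3 i t] at ht
      have hort := force_lorentz_orthogonal (univ.erase i) i m (fun j => w j t) (fun j => x j t)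
        (fun j => Y j t) (fun j => Z j t) (fun j => q i j t)
        (fun j => (q i j t ^ 2 - 1) ^ ((3:ℝ)/2)) (fun j => hq i j t) (by
          simp only [hw, hx]
          linear_combination hconstraint i t + r i t ^ 2 * hcs i t)
      have hdd := (deriv_hyperboloid (hrC i) (hYC i) (hZC i) (hconstraint i)).2 t
      have hK : deriv (w i) t ^ 2 + deriv (x i) t ^ 2 + deriv (Y i) t ^ 2 - deriv (Z i) t ^ 2 =
          deriv (r i) t ^ 2 + r i t ^ 2 * deriv α t ^ 2
            + deriv (Y i) t ^ 2 - deriv (Z i) t ^ 2 := by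
        rw [hw1, hx1]
        linear_combination (deriv (r i) t ^ 2 + r i t ^ 2 * deriv α t ^ 2) * hcs i t
      have hc := hconstraint i t
      have hcs := hcs i t
      rw [hw2, hx2]
      beta_reduce at ht hort
      set K := deriv (w i) t ^ 2 + deriv (x i) t ^ 2 + deriv (Y i) t ^ 2 - deriv (Z i) t ^ 2
      set Fw := ∑ j ∈ univ.erase i,
        m j * (w j t + q i j t * w i t) / (q i j t ^ 2 - 1) ^ ((3:ℝ)/2)
      set Fx := ∑ j ∈ univ.erase i,
        m j * (x j t + q i j t * x i t) / (q i j t ^ 2 - 1) ^ ((3:ℝ)/2)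
      set Fy := ∑ j ∈ univ.erase i,
        m j * (Y j t + q i j t * Y i t) / (q i j t ^ 2 - 1) ^ ((3:ℝ)/2)
      set Fz := ∑ j ∈ univ.erase i,
        m j * (Z j t + q i j t * Z i t) / (q i j t ^ 2 - 1) ^ ((3:ℝ)/2)
      rw [hw i t, hx i t] at hort
      rw [hw i t, hx i t]
      set c := cos (α t + a i)
      set s := sin (α t + a i)
      have hrad : deriv (deriv (r i)) t - r i t * deriv α t ^ 2 =
          c * Fw + s * Fx + K * r i t := by
        apply mul_left_cancel₀ (hrpos i t).ne'
        linear_combination hdd - Y i t * hy + Z i t * hz - hort - K * hc + hK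
      constructor
      · linear_combination c * hrad + s * ht + Fw * hcs
      · linear_combination s * hrad - c * ht + Fx * hcs
    rintro f (rfl | rfl | rfl | rfl) i t
    · exact (hwx i t).1
    · exact (hwx i t).2
    · exact hY i t
    · exact hZ i t
end

section
/- Consider the curved 3-body problem in H³ with three equal masses m > 0 and an Eulerian candidate of negative hyperbolic form: q_1 = (0, 0, sinh β, cosh β), q_2 = (w, x, ρ sinh β, ρ cosh β), q_3 = (−w, −x, ρ sinh β, ρ cosh β), where ρ := (w² + x² + 1)^{1/2}, w² + x² > 0, and β is nonconstant. If (q_1, q_2, q_3) solves the equations of motion in H³, then ρ (equivalently w² + x²) is constant in t, β̈ = 0, and all mutual Lorentz products q_12, q_13, q_23 are constant, i.e., every such solution is a relative equilibrium; moreover the total angular momenta relative to the wy-, wz-, xy-, and xz-planes vanish. -/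
open Real Finset

/-- Second derivative of `r * sinh b`. -/
lemma deriv_deriv_mul_sinh {r b : ℝ → ℝ} (hr : ContDiff ℝ 2 r) (hb : ContDiff ℝ 2 b) (t : ℝ) :
    deriv (deriv fun s => r s * Real.sinh (b s)) t =
      deriv (deriv r) t * Real.sinh (b t) + 2 * deriv r t * deriv b t * Real.cosh (b t)
        + r t * deriv (deriv b) t * Real.cosh (b t) + r t * deriv b t ^ 2 * Real.sinh (b t) := by
  have dr : ∀ s, HasDerivAt r (deriv r s) s := fun s =>
    (hr.differentiable (by norm_num) s).hasDerivAt
  have db : ∀ s, HasDerivAt b (deriv b s) s := fun s =>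
    (hb.differentiable (by norm_num) s).hasDerivAt
  have ddr := (hr.differentiable_deriv_two t).hasDerivAt
  have ddb := (hb.differentiable_deriv_two t).hasDerivAt
  have h : (deriv fun s => r s * Real.sinh (b s)) =
      fun s => deriv r s * Real.sinh (b s) + r s * (Real.cosh (b s) * deriv b s) :=
    funext fun s => ((dr s).mul (db s).sinh).deriv
  rw [h, ((ddr.fun_mul (db t).sinh).fun_add
    ((dr t).fun_mul ((db t).cosh.fun_mul ddb))).deriv]
  ring

/-- Second derivative of `r * cosh b`. -/
lemma deriv_deriv_mul_cosh {r b : ℝ → ℝ} (hr : ContDiff ℝ 2 r) (hb : ContDiff ℝ 2 b) (t : ℝ) :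
    deriv (deriv fun s => r s * Real.cosh (b s)) t =
      deriv (deriv r) t * Real.cosh (b t) + 2 * deriv r t * deriv b t * Real.sinh (b t)
        + r t * deriv (deriv b) t * Real.sinh (b t) + r t * deriv b t ^ 2 * Real.cosh (b t) := by
  have dr : ∀ s, HasDerivAt r (deriv r s) s := fun s =>
    (hr.differentiable (by norm_num) s).hasDerivAt
  have db : ∀ s, HasDerivAt b (deriv b s) s := fun s =>
    (hb.differentiable (by norm_num) s).hasDerivAt
  have ddr := (hr.differentiable_deriv_two t).hasDerivAt
  have ddb := (hb.differentiable_deriv_two t).hasDerivAt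
  have h : (deriv fun s => r s * Real.cosh (b s)) =
      fun s => deriv r s * Real.cosh (b s) + r s * (Real.sinh (b s) * deriv b s) :=
    funext fun s => ((dr s).mul (db s).cosh).deriv
  rw [h, ((ddr.fun_mul (db t).cosh).fun_add
    ((dr t).fun_mul ((db t).sinh.fun_mul ddb))).deriv]
  ring

/-- Negative hyperbolic Eulerian orbits of the 3-body problem in H³ are
relative equilibria. -/
theorem negative_hyperbolic_eulerian_three_body
    (m : ℝ) (hm : 0 < m)
    (β w x ρ : ℝ → ℝ)
    (hβC : ContDiff ℝ 2 β) (hwC : ContDiff ℝ 2 w) (hxC : ContDiff ℝ 2 x)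
    (hβnc : ∃ t₁ t₂, β t₁ ≠ β t₂)
    (hρ : ∀ t, ρ t = Real.sqrt (w t ^ 2 + x t ^ 2 + 1))
    (hwx : ∀ t, 0 < w t ^ 2 + x t ^ 2)
    (W X Y Z : Fin 3 → ℝ → ℝ)
    (hW0 : ∀ t, W 0 t = 0) (hW1 : ∀ t, W 1 t = w t) (hW2 : ∀ t, W 2 t = -w t)
    (hX0 : ∀ t, X 0 t = 0) (hX1 : ∀ t, X 1 t = x t) (hX2 : ∀ t, X 2 t = -x t)
    (hY0 : ∀ t, Y 0 t = Real.sinh (β t))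
    (hY1 : ∀ t, Y 1 t = ρ t * Real.sinh (β t))
    (hY2 : ∀ t, Y 2 t = ρ t * Real.sinh (β t))
    (hZ0 : ∀ t, Z 0 t = Real.cosh (β t))
    (hZ1 : ∀ t, Z 1 t = ρ t * Real.cosh (β t))
    (hZ2 : ∀ t, Z 2 t = ρ t * Real.cosh (β t))
    (q : Fin 3 → Fin 3 → ℝ → ℝ)
    (hq : ∀ i j t, q i j t =
      W i t * W j t + X i t * X j t + Y i t * Y j t - Z i t * Z j t)
    (hreg : ∀ i j, i ≠ j → ∀ t, q i j t ^ 2 ≠ 1)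
    -- (q₁,q₂,q₃) solves the equations of motion in H³
    (hsol : ∀ f : Fin 3 → ℝ → ℝ, (f = W ∨ f = X ∨ f = Y ∨ f = Z) → ∀ i t,
        deriv (deriv (f i)) t =
          (∑ j ∈ Finset.univ.erase i,
            m * (f j t + q i j t * f i t) / (q i j t ^ 2 - 1) ^ ((3:ℝ)/2))
          + (deriv (W i) t ^ 2 + deriv (X i) t ^ 2 + deriv (Y i) t ^ 2
              - deriv (Z i) t ^ 2) * f i t) :
    -- ρ (equivalently w² + x²) is constant in t
    (∀ t₁ t₂, ρ t₁ = ρ t₂) ∧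
    (∀ t₁ t₂, w t₁ ^ 2 + x t₁ ^ 2 = w t₂ ^ 2 + x t₂ ^ 2) ∧
    -- β̈ = 0
    (∀ t, deriv (deriv β) t = 0) ∧
    -- all mutual Lorentz products are constant: relative equilibrium
    (∀ i j, ∀ t₁ t₂, q i j t₁ = q i j t₂) ∧
    -- angular momenta relative to the wy-, wz-, xy-, xz-planes vanish
    (∀ t,
      (∑ i, m * (W i t * deriv (Y i) t - deriv (W i) t * Y i t) = 0) ∧
      (∑ i, m * (W i t * deriv (Z i) t - deriv (W i) t * Z i t) = 0) ∧
      (∑ i, m * (X i t * deriv (Y i) t - deriv (X i) t * Y i t) = 0) ∧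
      (∑ i, m * (X i t * deriv (Z i) t - deriv (X i) t * Z i t) = 0)) := by
  have hρsq : ∀ t, ρ t ^ 2 = w t ^ 2 + x t ^ 2 + 1 := fun t => by
    rw [hρ, Real.sq_sqrt (by positivity)]
  have hρC : ContDiff ℝ 2 ρ := by
    rw [funext hρ]
    exact (((hwC.pow 2).add (hxC.pow 2)).add contDiff_const).sqrt fun t => by positivity
  have eW0 : W 0 = fun _ => 0 := funext hW0
  have eX0 : X 0 = fun _ => 0 := funext hX0
  have eW1 : W 1 = w := funext hW1
  have eX1 : X 1 = x := funext hX1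
  have eW2 : W 2 = fun t => -w t := funext hW2
  have eX2 : X 2 = fun t => -x t := funext hX2
  have eY0 : Y 0 = fun t => Real.sinh (β t) := funext hY0
  have eZ0 : Z 0 = fun t => Real.cosh (β t) := funext hZ0
  have eY1 : Y 1 = fun t => ρ t * Real.sinh (β t) := funext hY1
  have eY2 : Y 2 = fun t => ρ t * Real.sinh (β t) := funext hY2
  have eZ1 : Z 1 = fun t => ρ t * Real.cosh (β t) := funext hZ1
  have eZ2 : Z 2 = fun t => ρ t * Real.cosh (β t) := funext hZ2
  have er0 : (Finset.univ.erase 0 : Finset (Fin 3)) = {1, 2} := by decide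
  have er1 : (Finset.univ.erase 1 : Finset (Fin 3)) = {0, 2} := by decide
  have hβ2 : ∀ t, deriv (deriv β) t = 0 := by
    intro t
    have db : HasDerivAt β (deriv β t) t := (hβC.differentiable (by norm_num) t).hasDerivAt
    have hq01 : q 0 1 t = -ρ t := by
      rw [hq, hW0, hX0, hY0, hZ0, hY1, hZ1]
      linear_combination -ρ t * Real.cosh_sq_sub_sinh_sq (β t)
    have hq02 : q 0 2 t = -ρ t := by
      rw [hq, hW0, hX0, hY0, hZ0, hY2, hZ2]
      linear_combination -ρ t * Real.cosh_sq_sub_sinh_sq (β t)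
    have h := hsol Y (by simp) 0 t
    rw [er0, Finset.sum_pair (by decide), hq01, hq02, hY1, hY2, hY0, eW0, eX0, eY0, eZ0,
      db.sinh.deriv, db.cosh.deriv] at h
    have h2 := deriv_deriv_mul_sinh (contDiff_const (c := (1 : ℝ))) hβC t
    simp only [one_mul, deriv_const', deriv_const, zero_mul, mul_zero, zero_add] at h2
    rw [h2] at h
    have h3 : Real.cosh (β t) * deriv (deriv β) t = 0 := by
      have e : ρ t * Real.sinh (β t) + -ρ t * Real.sinh (β t) = 0 := by ring
      simp only [e, mul_zero, zero_div, deriv_const] at h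
      linear_combination h
        + deriv β t ^ 2 * Real.sinh (β t) * Real.cosh_sq_sub_sinh_sq (β t)
    exact (mul_eq_zero.mp h3).resolve_left (Real.cosh_pos _).ne'
  have hβ1 : ∀ t, deriv β t ≠ 0 := by
    intro t h0
    obtain ⟨t₁, t₂, hne⟩ := hβnc
    refine hne (is_const_of_deriv_eq_zero (hβC.differentiable (by norm_num)) (fun s => ?_) t₁ t₂)
    rw [is_const_of_deriv_eq_zero hβC.differentiable_deriv_two hβ2 s t, h0]
  have hρ1 : ∀ t, deriv ρ t = 0 := by
    intro t
    have hY := hsol Y (by simp) 1 t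
    have hZ := hsol Z (by simp) 1 t
    have sY := deriv_deriv_mul_sinh hρC hβC t
    have sZ := deriv_deriv_mul_cosh hρC hβC t
    rw [← eY1, hY, er1, Finset.sum_pair (by decide), hY0, hY1, hY2, hβ2] at sY
    rw [← eZ1, hZ, er1, Finset.sum_pair (by decide), hZ0, hZ1, hZ2, hβ2] at sZ
    have h : 2 * deriv ρ t * deriv β t = 0 := by
      linear_combination Real.sinh (β t) * sZ - Real.cosh (β t) * sY
        - 2 * deriv ρ t * deriv β t * Real.cosh_sq_sub_sinh_sq (β t)
    have := hβ1 t
    simpa [this] using h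
  have hρc : ∀ t₁ t₂, ρ t₁ = ρ t₂ :=
    is_const_of_deriv_eq_zero (hρC.differentiable (by norm_num)) hρ1
  have hwxc : ∀ t₁ t₂, w t₁ ^ 2 + x t₁ ^ 2 = w t₂ ^ 2 + x t₂ ^ 2 := fun t₁ t₂ => by
    linear_combination hρsq t₂ - hρsq t₁ + (ρ t₁ + ρ t₂) * hρc t₁ t₂
  refine ⟨hρc, hwxc, hβ2, fun i j t₁ t₂ => ?_, fun t => ?_⟩
  · have c₁ := Real.cosh_sq_sub_sinh_sq (β t₁)
    have c₂ := Real.cosh_sq_sub_sinh_sq (β t₂)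
    have hr := hρc t₁ t₂
    have hs := hwxc t₁ t₂
    rw [hq, hq]
    fin_cases i <;> fin_cases j <;>
      simp only [Fin.zero_eta, Fin.mk_one, Fin.reduceFinMk, hW0, hW1, hW2, hX0, hX1, hX2,
        hY0, hY1, hY2, hZ0, hZ1, hZ2, hr]
    · linear_combination c₂ - c₁
    · linear_combination ρ t₂ * (c₂ - c₁)
    · linear_combination ρ t₂ * (c₂ - c₁)
    · linear_combination ρ t₂ * (c₂ - c₁)
    · linear_combination hs + ρ t₂ ^ 2 * (c₂ - c₁)
    · linear_combination -hs + ρ t₂ ^ 2 * (c₂ - c₁)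
    · linear_combination ρ t₂ * (c₂ - c₁)
    · linear_combination -hs + ρ t₂ ^ 2 * (c₂ - c₁)
    · linear_combination hs + ρ t₂ ^ 2 * (c₂ - c₁)
  · have dw : deriv (fun s => -w s) t = -deriv w t := deriv.fun_neg
    have dx : deriv (fun s => -x s) t = -deriv x t := deriv.fun_neg
    simp only [Fin.sum_univ_three, eW0, eW1, eW2, eX0, eX1, eX2, eY1, eY2, eZ1, eZ2,
      dw, dx, deriv_const]
    refine ⟨?_, ?_, ?_, ?_⟩ <;> ring
end

section
/- Let q = (q_1,…,q_N) be a solution of the curved N-body problem in H³ of negative elliptic-hyperbolic form, with r_i(t) > 0, q_ij(t)² ≠ 1 for i ≠ j, and α̇ = d_1/(Σ_{j=1}^N m_j r_j²), β̇ = d_2/(M + Σ_{j=1}^N m_j r_j²) for constants d_1, d_2 ≠ 0, where M := Σ_i m_i. Then for all t: (a) the energy h(t) := Σ_{i=1}^N m_i ṙ_i²/(2(1 + r_i²)) + d_1²/(2 Σ_{j} m_j r_j²) + d_2²/(2(M + Σ_{j} m_j r_j²)) + Σ_{1≤i<j≤N} m_i m_j q_ij/(q_ij² − 1)^{1/2}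 is constant; (b) Σ_{i=1}^N m_i (w_i ẋ_i − ẇ_i x_i) = d_1; (c) Σ_{i=1}^N m_i (y_i ż_i − ẏ_i z_i) = −d_2; (d) d_2/β̇ − d_1/α̇ = M. -/
open Real Finset

/-- The derivative of the pair potential `q / √(q² - 1)` along a curve. -/
lemma hasDerivAt_div_sqrt_sq_sub_one {q : ℝ → ℝ} {q' t : ℝ} (hq : HasDerivAt q q' t)
    (h : 0 < q t ^ 2 - 1) :
    HasDerivAt (fun s => q s / √(q s ^ 2 - 1)) (-(q' / (q t ^ 2 - 1) ^ ((3 : ℝ) / 2))) t := by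
  have hs : HasDerivAt (fun s => √(q s ^ 2 - 1)) (q t * q' / √(q t ^ 2 - 1)) t := by
    refine (((hq.fun_pow 2).sub_const 1).sqrt h.ne').congr_deriv ?_
    norm_num
    field_simp
  have hpos : 0 < √(q t ^ 2 - 1) := Real.sqrt_pos.2 h
  have hrpow : (q t ^ 2 - 1) ^ ((3 : ℝ) / 2) = √(q t ^ 2 - 1) ^ 3 := by
    rw [Real.sqrt_eq_rpow, ← Real.rpow_mul_natCast h.le]
    norm_num
  refine (hq.fun_div hs hpos.ne').congr_deriv ?_
  rw [hrpow]
  field_simp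
  rw [Real.sq_sqrt h.le]
  ring

/-- Points of the unit hyperboloid in elliptic-hyperbolic coordinates have Lorentz product
at most `-1`. -/
lemma lorentz_prod_le_neg_one {r₁ r₂ ρ₁ ρ₂ θ₁ θ₂ φ₁ φ₂ : ℝ} (hr₁ : 0 ≤ r₁) (hr₂ : 0 ≤ r₂)
    (hρ₁ : ρ₁ = √(1 + r₁ ^ 2)) (hρ₂ : ρ₂ = √(1 + r₂ ^ 2)) :
    r₁ * cos θ₁ * (r₂ * cos θ₂) + r₁ * sin θ₁ * (r₂ * sin θ₂)
      + ρ₁ * Real.sinh φ₁ * (ρ₂ * Real.sinh φ₂)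
      - ρ₁ * Real.cosh φ₁ * (ρ₂ * Real.cosh φ₂) ≤ -1 := by
  have hρ : 1 + r₁ * r₂ ≤ ρ₁ * ρ₂ := by
    rw [hρ₁, hρ₂, ← Real.sqrt_mul (by positivity)]
    apply Real.le_sqrt_of_sq_le
    nlinarith [sq_nonneg (r₁ - r₂)]
  have hρ0 : 0 ≤ ρ₁ * ρ₂ := by rw [hρ₁, hρ₂]; positivity
  have hcos : r₁ * r₂ * cos (θ₁ - θ₂) ≤ r₁ * r₂ :=
    mul_le_of_le_one_right (mul_nonneg hr₁ hr₂) (cos_le_one _)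
  have hcosh : ρ₁ * ρ₂ ≤ ρ₁ * ρ₂ * Real.cosh (φ₁ - φ₂) :=
    le_mul_of_one_le_right hρ0 (Real.one_le_cosh _)
  rw [cos_sub] at hcos
  rw [Real.cosh_sub] at hcosh
  linarith

/-- Conservation of energy for the curved `N`-body problem on the unit hyperboloid. -/
lemma hasDerivAt_lorentz_energy {N : ℕ} {m : Fin N → ℝ} {w x Y Z : Fin N → ℝ → ℝ}
    {q : Fin N → Fin N → ℝ → ℝ}
    (hwC : ∀ i, ContDiff ℝ 2 (w i)) (hxC : ∀ i, ContDiff ℝ 2 (x i))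
    (hYC : ∀ i, ContDiff ℝ 2 (Y i)) (hZC : ∀ i, ContDiff ℝ 2 (Z i))
    (hq : ∀ i j t, q i j t = w i t * w j t + x i t * x j t + Y i t * Y j t - Z i t * Z j t)
    (hnorm : ∀ i t, q i i t = -1) (hreg : ∀ i j, i ≠ j → ∀ t, 0 < q i j t ^ 2 - 1)
    (hsol : ∀ f : Fin N → ℝ → ℝ, (f = w ∨ f = x ∨ f = Y ∨ f = Z) → ∀ i t,
        deriv (deriv (f i)) t =
          (∑ j ∈ Finset.univ.erase i,
            m j * (f j t + q i j t * f i t) / (q i j t ^ 2 - 1) ^ ((3:ℝ)/2))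
          + (deriv (w i) t ^ 2 + deriv (x i) t ^ 2 + deriv (Y i) t ^ 2
              - deriv (Z i) t ^ 2) * f i t) (t : ℝ) :
    HasDerivAt (fun t =>
      (∑ i, m i * ((deriv (w i) t ^ 2 + deriv (x i) t ^ 2 + deriv (Y i) t ^ 2
        - deriv (Z i) t ^ 2) / 2))
      + ∑ i, ∑ j ∈ Finset.univ.filter (fun j => i < j),
          m i * m j * q i j t / √(q i j t ^ 2 - 1)) 0 t := by
  have hD {f : ℝ → ℝ} (hf : ContDiff ℝ 2 f) : HasDerivAt f (deriv f t) t :=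
    (hf.differentiable (by norm_num) t).hasDerivAt
  have hDD {f : ℝ → ℝ} (hf : ContDiff ℝ 2 f) : HasDerivAt (deriv f) (deriv (deriv f) t) t :=
    (hf.differentiable_deriv_two t).hasDerivAt
  let A : Fin N → Fin N → ℝ := fun i j =>
    deriv (w i) t * w j t + deriv (x i) t * x j t + deriv (Y i) t * Y j t - deriv (Z i) t * Z j t
  have hqD (i j) : HasDerivAt (q i j) (A i j + A j i) t := by
    rw [show q i j = _ from funext (hq i j)]
    refine (((((hD (hwC i)).fun_mul (hD (hwC j))).fun_add
      ((hD (hxC i)).fun_mul (hD (hxC j)))).fun_add ((hD (hYC i)).fun_mul (hD (hYC j)))).fun_sub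
      ((hD (hZC i)).fun_mul (hD (hZC j)))).congr_deriv ?_
    simp only [A]
    ring
  have hA0 (i) : A i i = 0 := by
    have h := (hqD i i).unique (by
      rw [show q i i = fun _ => -1 from funext (hnorm i)]; exact hasDerivAt_const t (-1 : ℝ))
    linarith
  let G : Fin N → Fin N → ℝ := fun i j => m i * m j * A i j / (q i j t ^ 2 - 1) ^ ((3 : ℝ) / 2)
  have hkin (i) : HasDerivAt (fun t => m i * ((deriv (w i) t ^ 2 + deriv (x i) t ^ 2
      + deriv (Y i) t ^ 2 - deriv (Z i) t ^ 2) / 2)) (∑ j ∈ Finset.univ.erase i, G i j) t := by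
    refine (((((((hDD (hwC i)).fun_pow 2).fun_add ((hDD (hxC i)).fun_pow 2)).fun_add
      ((hDD (hYC i)).fun_pow 2)).fun_sub ((hDD (hZC i)).fun_pow 2)).div_const 2).const_mul
      (m i)).congr_deriv ?_
    rw [hsol w (by simp), hsol x (by simp), hsol Y (by simp), hsol Z (by simp)]
    set K := deriv (w i) t ^ 2 + deriv (x i) t ^ 2 + deriv (Y i) t ^ 2 - deriv (Z i) t ^ 2
    have hsum : ∑ j ∈ Finset.univ.erase i, G i j =
        m i * (deriv (w i) t * (∑ j ∈ Finset.univ.erase i,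
            m j * (w j t + q i j t * w i t) / (q i j t ^ 2 - 1) ^ ((3:ℝ)/2))
          + deriv (x i) t * (∑ j ∈ Finset.univ.erase i,
            m j * (x j t + q i j t * x i t) / (q i j t ^ 2 - 1) ^ ((3:ℝ)/2))
          + deriv (Y i) t * (∑ j ∈ Finset.univ.erase i,
            m j * (Y j t + q i j t * Y i t) / (q i j t ^ 2 - 1) ^ ((3:ℝ)/2))
          - deriv (Z i) t * (∑ j ∈ Finset.univ.erase i,
            m j * (Z j t + q i j t * Z i t) / (q i j t ^ 2 - 1) ^ ((3:ℝ)/2))) := by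
      simp only [Finset.mul_sum, ← Finset.sum_add_distrib, ← Finset.sum_sub_distrib]
      refine Finset.sum_congr rfl fun j _ => ?_
      have h := hA0 i
      simp only [A] at h
      simp only [G, A]
      linear_combination (-(m i * m j * q i j t / (q i j t ^ 2 - 1) ^ ((3:ℝ)/2))) * h
    rw [hsum]
    have h := hA0 i
    simp only [A] at h
    simp only [Nat.cast_ofNat, Nat.add_one_sub_one, pow_one]
    linear_combination m i * K * h
  have hpot (i j) (hij : i < j) : HasDerivAt (fun t => m i * m j * q i j t / √(q i j t ^ 2 - 1))
      (-(G j i + G i j)) t := by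
    simp only [mul_div_assoc (m i * m j)]
    refine ((hasDerivAt_div_sqrt_sq_sub_one (hqD i j) (hreg i j hij.ne t)).const_mul
      (m i * m j)).congr_deriv ?_
    have hsymm : q j i t = q i j t := by rw [hq, hq]; ring
    simp only [G, hsymm]
    ring
  refine ((HasDerivAt.fun_sum fun i (_ : i ∈ Finset.univ) => hkin i).fun_add
    (HasDerivAt.fun_sum fun i (_ : i ∈ Finset.univ) => HasDerivAt.fun_sum fun j
      (hj : j ∈ Finset.univ.filter (fun j => i < j)) =>
        hpot i j (Finset.mem_filter.1 hj).2)).congr_deriv ?_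
  have hpairs := Finset.sum_sum_Ioi_add_eq_sum_sum_off_diag (fun i j => G j i)
  simp only [Finset.compl_singleton] at hpairs
  simp only [Finset.sum_neg_distrib, Finset.filter_lt_eq_Ioi, ← hpairs, add_comm (G _ _) (G _ _),
    add_neg_cancel]

/-- Conservation laws for negative elliptic-hyperbolic rotopulsators in H³. -/
theorem negative_elliptic_hyperbolic_conservation
    (N : ℕ) (hN : 2 ≤ N)
    (m a b : Fin N → ℝ) (hm : ∀ i, 0 < m i)
    (α β : ℝ → ℝ) (r ρ w x Y Z : Fin N → ℝ → ℝ)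
    (hαC : ContDiff ℝ 2 α) (hβC : ContDiff ℝ 2 β)
    (hrC : ∀ i, ContDiff ℝ 2 (r i))
    (hρ : ∀ i t, ρ i t = Real.sqrt (1 + r i t ^ 2))
    (hw : ∀ i t, w i t = r i t * cos (α t + a i))
    (hx : ∀ i t, x i t = r i t * sin (α t + a i))
    (hY : ∀ i t, Y i t = ρ i t * Real.sinh (β t + b i))
    (hZ : ∀ i t, Z i t = ρ i t * Real.cosh (β t + b i))
    (hrpos : ∀ i t, 0 < r i t)
    (q : Fin N → Fin N → ℝ → ℝ)
    (hq : ∀ i j t, q i j t =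
      w i t * w j t + x i t * x j t + Y i t * Y j t - Z i t * Z j t)
    (hreg : ∀ i j, i ≠ j → ∀ t, q i j t ^ 2 ≠ 1)
    (hsol : ∀ f : Fin N → ℝ → ℝ, (f = w ∨ f = x ∨ f = Y ∨ f = Z) → ∀ i t,
        deriv (deriv (f i)) t =
          (∑ j ∈ Finset.univ.erase i,
            m j * (f j t + q i j t * f i t) / (q i j t ^ 2 - 1) ^ ((3:ℝ)/2))
          + (deriv (w i) t ^ 2 + deriv (x i) t ^ 2 + deriv (Y i) t ^ 2
              - deriv (Z i) t ^ 2) * f i t)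
    (d₁ d₂ : ℝ) (hd₁ : d₁ ≠ 0) (hd₂ : d₂ ≠ 0)
    (hαdot : ∀ t, deriv α t = d₁ / ∑ j, m j * r j t ^ 2)
    (hβdot : ∀ t, deriv β t = d₂ / ((∑ i, m i) + ∑ j, m j * r j t ^ 2)) :
    -- (a) the energy is constant
    (∃ h₀ : ℝ, ∀ t,
      (∑ i, m i * deriv (r i) t ^ 2 / (2 * (1 + r i t ^ 2)))
      + d₁ ^ 2 / (2 * ∑ j, m j * r j t ^ 2)
      + d₂ ^ 2 / (2 * ((∑ i, m i) + ∑ j, m j * r j t ^ 2))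
      + (∑ i, ∑ j ∈ Finset.univ.filter (fun j => i < j),
          m i * m j * q i j t / Real.sqrt (q i j t ^ 2 - 1)) = h₀) ∧
    -- (b) angular momentum relative to the wx-plane
    (∀ t, ∑ i, m i * (w i t * deriv (x i) t - deriv (w i) t * x i t) = d₁) ∧
    -- (c) angular momentum relative to the yz-plane
    (∀ t, ∑ i, m i * (Y i t * deriv (Z i) t - deriv (Y i) t * Z i t) = -d₂) ∧
    -- (d)
    (∀ t, d₂ / deriv β t - d₁ / deriv α t = ∑ i, m i) := by
 
  have : Nonempty (Fin N) := ⟨⟨0, by omega⟩⟩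
  have hS (t) : 0 < ∑ j, m j * r j t ^ 2 :=
    Finset.sum_pos (fun j _ => mul_pos (hm j) (pow_pos (hrpos j t) 2)) Finset.univ_nonempty
  have hM : 0 < ∑ j, m j := Finset.sum_pos (fun j _ => hm j) Finset.univ_nonempty
  have hMS (t) : 0 < (∑ i, m i) + ∑ j, m j * r j t ^ 2 := add_pos hM (hS t)
  have hρpos (i t) : 0 < ρ i t := by rw [hρ]; positivity
  have hρsq (i t) : ρ i t ^ 2 = 1 + r i t ^ 2 := by rw [hρ, Real.sq_sqrt (by positivity)]
  have hρC (i) : ContDiff ℝ 2 (ρ i) := by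
    rw [show ρ i = _ from funext (hρ i)]
    exact (contDiff_const.add ((hrC i).pow 2)).sqrt fun t => by positivity
  have hwC (i) : ContDiff ℝ 2 (w i) := by
    rw [show w i = _ from funext (hw i)]
    exact (hrC i).mul (hαC.add contDiff_const).cos
  have hxC (i) : ContDiff ℝ 2 (x i) := by
    rw [show x i = _ from funext (hx i)]
    exact (hrC i).mul (hαC.add contDiff_const).sin
  have hYC (i) : ContDiff ℝ 2 (Y i) := by
    rw [show Y i = _ from funext (hY i)]
    exact (hρC i).mul (hβC.add contDiff_const).sinh
  have hZC (i) : ContDiff ℝ 2 (Z i) := by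
    rw [show Z i = _ from funext (hZ i)]
    exact (hρC i).mul (hβC.add contDiff_const).cosh
  have hD {f : ℝ → ℝ} (hf : ContDiff ℝ 2 f) (t) : HasDerivAt f (deriv f t) t :=
    (hf.differentiable (by norm_num) t).hasDerivAt
  have hdρ (i t) : ρ i t * deriv (ρ i) t = r i t * deriv (r i) t := by
    have h₁ := (hD (hρC i) t).pow 2
    rw [show ρ i ^ 2 = fun s => 1 + r i s ^ 2 from funext (hρsq i)] at h₁
    have h₂ := h₁.unique (((hD (hrC i) t).pow 2).const_add 1)
    norm_num at h₂
    linarith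
  have hdw (i t) : deriv (w i) t =
      deriv (r i) t * cos (α t + a i) - r i t * sin (α t + a i) * deriv α t := by
    rw [show w i = _ from funext (hw i)]
    rw [((hD (hrC i) t).fun_mul ((hD hαC t).add_const (a i)).cos).deriv]
    ring
  have hdx (i t) : deriv (x i) t =
      deriv (r i) t * sin (α t + a i) + r i t * cos (α t + a i) * deriv α t := by
    rw [show x i = _ from funext (hx i)]
    rw [((hD (hrC i) t).fun_mul ((hD hαC t).add_const (a i)).sin).deriv]
    ring
  have hdY (i t) : deriv (Y i) t =
      deriv (ρ i) t * Real.sinh (β t + b i) + ρ i t * Real.cosh (β t + b i) * deriv β t := by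
    rw [show Y i = _ from funext (hY i)]
    rw [((hD (hρC i) t).fun_mul ((hD hβC t).add_const (b i)).sinh).deriv]
    ring
  have hdZ (i t) : deriv (Z i) t =
      deriv (ρ i) t * Real.cosh (β t + b i) + ρ i t * Real.sinh (β t + b i) * deriv β t := by
    rw [show Z i = _ from funext (hZ i)]
    rw [((hD (hρC i) t).fun_mul ((hD hβC t).add_const (b i)).cosh).deriv]
    ring
  have hαS (t) : (∑ j, m j * r j t ^ 2) * deriv α t = d₁ := by
    rw [hαdot, mul_div_cancel₀ _ (hS t).ne']
  have hβS (t) : ((∑ i, m i) + ∑ j, m j * r j t ^ 2) * deriv β t = d₂ := by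
    rw [hβdot, mul_div_cancel₀ _ (hMS t).ne']
  have hρS (t) : ∑ i, m i * ρ i t ^ 2 = (∑ i, m i) + ∑ j, m j * r j t ^ 2 := by
    simp only [hρsq, mul_add, mul_one, Finset.sum_add_distrib]
  have hnorm (i t) : q i i t = -1 := by
    rw [hq, hw, hx, hY, hZ]
    linear_combination r i t ^ 2 * cos_sq_add_sin_sq (α t + a i)
      - ρ i t ^ 2 * Real.cosh_sq_sub_sinh_sq (β t + b i) - hρsq i t
  have hqpos (i j) (hij : i ≠ j) (t) : 0 < q i j t ^ 2 - 1 := by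
    have hle : q i j t ≤ -1 := by
      rw [hq, hw, hw, hx, hx, hY, hY, hZ, hZ]
      exact lorentz_prod_le_neg_one (hrpos i t).le (hrpos j t).le (hρ i t) (hρ j t)
    exact lt_of_le_of_ne (by nlinarith) (sub_ne_zero.2 (hreg i j hij t)).symm
  have hspeed (i t) : deriv (w i) t ^ 2 + deriv (x i) t ^ 2 + deriv (Y i) t ^ 2
      - deriv (Z i) t ^ 2 = deriv (r i) t ^ 2 / (1 + r i t ^ 2) + r i t ^ 2 * deriv α t ^ 2
        + ρ i t ^ 2 * deriv β t ^ 2 := by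
    have hradial : deriv (r i) t ^ 2 - deriv (ρ i) t ^ 2 = deriv (r i) t ^ 2 / (1 + r i t ^ 2) := by
      have h0 : 1 + r i t ^ 2 ≠ 0 := by positivity
      rw [eq_div_iff h0]
      linear_combination deriv (ρ i) t ^ 2 * hρsq i t
        - (ρ i t * deriv (ρ i) t + r i t * deriv (r i) t) * hdρ i t
    rw [← hradial, hdw, hdx, hdY, hdZ]
    linear_combination (deriv (r i) t ^ 2 + r i t ^ 2 * deriv α t ^ 2)
        * cos_sq_add_sin_sq (α t + a i)
      + (ρ i t ^ 2 * deriv β t ^ 2 - deriv (ρ i) t ^ 2) * Real.cosh_sq_sub_sinh_sq (β t + b i)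
  refine ⟨?_, fun t => ?_, fun t => ?_, fun t => ?_⟩
  · have hE := hasDerivAt_lorentz_energy hwC hxC hYC hZC hq hnorm hqpos hsol
    refine ⟨_, fun t => Eq.trans ?_ (is_const_of_deriv_eq_zero
      (fun s => (hE s).differentiableAt) (fun s => (hE s).deriv) t 0)⟩
    simp only [add_left_inj]
    have hα : d₁ ^ 2 / (2 * ∑ j, m j * r j t ^ 2)
        = (∑ j, m j * r j t ^ 2) * (deriv α t ^ 2 / 2) := by
      rw [hαdot]
      field_simp [(hS t).ne']
    have hβ : d₂ ^ 2 / (2 * ((∑ i, m i) + ∑ j, m j * r j t ^ 2))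
        = (∑ i, m i * ρ i t ^ 2) * (deriv β t ^ 2 / 2) := by
      rw [hβdot, hρS]
      field_simp [(hMS t).ne']
    rw [hα, hβ, Finset.sum_mul, Finset.sum_mul, ← Finset.sum_add_distrib,
      ← Finset.sum_add_distrib]
    refine Finset.sum_congr rfl fun i _ => ?_
    rw [hspeed]
    field_simp
  · rw [← hαS t, Finset.sum_mul]
    refine Finset.sum_congr rfl fun i _ => ?_
    rw [hdw, hdx, hw, hx]
    linear_combination m i * r i t ^ 2 * deriv α t * cos_sq_add_sin_sq (α t + a i)
  · rw [← hβS t, ← hρS, Finset.sum_mul, ← Finset.sum_neg_distrib]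
    refine Finset.sum_congr rfl fun i _ => ?_
    rw [hdY, hdZ, hY, hZ]
    linear_combination -(m i * ρ i t ^ 2 * deriv β t) * Real.cosh_sq_sub_sinh_sq (β t + b i)
  · rw [hαdot, hβdot, div_div_cancel₀ hd₁, div_div_cancel₀ hd₂, add_sub_cancel_right]
end

section
/- Let q = (q_1,…,q_N) be a solution of the curved N-body problem in H³ of negative elliptic-hyperbolic form (this includes the negative elliptic case, obtained by taking β constant, and the negative hyperbolic case, obtained by taking α constant). Suppose each body is confined to a hyperbolic cylinder: for each i there are constants r^i ≥ 0 and ρ^i > 0 with (r^i)² − (ρ^i)² = −1 such that w_i(t)² + x_i(t)² = (r^i)² and z_i(t)² − y_i(t)² = (ρ^i)² for all t. Then every mutual Lorentz product q_ij := q_i ⊙ q_j is constant in t, i.e., the solution is a relative equilibrium. Consequently, if q is a rotopulsator (some q_ij with i ≠ j is nonconstant), then for any foliation of H³ by hyperbolic cylinders at least one body's trajectory is not contained in a single hyperbolic cylinder. -/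
open Real Finset

/-- If every body of a negative elliptic-hyperbolic solution in H³ is confined
to a hyperbolic cylinder, then all mutual Lorentz products are constant (the
solution is a relative equilibrium); hence a rotopulsator has at least one body
whose trajectory meets a continuum of hyperbolic cylinders. -/
theorem hyperbolic_cylinders_confinement
    (N : ℕ) (hN : 2 ≤ N)
    (m a b : Fin N → ℝ) (hm : ∀ i, 0 < m i)
    (α β : ℝ → ℝ) (r ρ w x Y Z : Fin N → ℝ → ℝ)
    (hαC : ContDiff ℝ 2 α) (hβC : ContDiff ℝ 2 β)
    (hrC : ∀ i, ContDiff ℝ 2 (r i))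
    (hρ : ∀ i t, ρ i t = Real.sqrt (1 + r i t ^ 2))
    (hr0 : ∀ i t, 0 ≤ r i t)
    (hw : ∀ i t, w i t = r i t * cos (α t + a i))
    (hx : ∀ i t, x i t = r i t * sin (α t + a i))
    (hY : ∀ i t, Y i t = ρ i t * Real.sinh (β t + b i))
    (hZ : ∀ i t, Z i t = ρ i t * Real.cosh (β t + b i))
    (q : Fin N → Fin N → ℝ → ℝ)
    (hq : ∀ i j t, q i j t =
      w i t * w j t + x i t * x j t + Y i t * Y j t - Z i t * Z j t)
    (hreg : ∀ i j, i ≠ j → ∀ t, q i j t ^ 2 ≠ 1)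
    -- q solves the equations of motion in H³
    (hsol : ∀ f : Fin N → ℝ → ℝ, (f = w ∨ f = x ∨ f = Y ∨ f = Z) → ∀ i t,
        deriv (deriv (f i)) t =
          (∑ j ∈ Finset.univ.erase i,
            m j * (f j t + q i j t * f i t) / (q i j t ^ 2 - 1) ^ ((3:ℝ)/2))
          + (deriv (w i) t ^ 2 + deriv (x i) t ^ 2 + deriv (Y i) t ^ 2
              - deriv (Z i) t ^ 2) * f i t)
    -- each body is confined to a hyperbolic cylinder
    (hconf : ∀ i, ∃ R P : ℝ, 0 ≤ R ∧ 0 < P ∧ R ^ 2 - P ^ 2 = -1 ∧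
      ∀ t, w i t ^ 2 + x i t ^ 2 = R ^ 2 ∧ Z i t ^ 2 - Y i t ^ 2 = P ^ 2) :
    -- then every mutual Lorentz product is constant: the solution is a
    -- relative equilibrium (so it is not a rotopulsator)
    ∀ i j, ∀ t₁ t₂, q i j t₁ = q i j t₂ := by
  have hr : ∀ i, ∃ R : ℝ, ∀ t, r i t = R := by
    intro i
    obtain ⟨R, _, hR, -, -, h⟩ := hconf i
    refine ⟨R, fun t => (pow_left_inj₀ (hr0 i t) hR two_ne_zero).1 ?_⟩
    rw [← (h t).1, hw, hx]
    linear_combination -r i t ^ 2 * Real.sin_sq_add_cos_sq (α t + a i)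
  choose R hR using hr
  have key : ∀ i j t, q i j t = R i * R j * Real.cos (a i - a j)
      - √(1 + R i ^ 2) * √(1 + R j ^ 2) * Real.cosh (b i - b j) := by
    intro i j t
    have hcos := Real.cos_sub (α t + a i) (α t + a j)
    have hcosh := Real.cosh_sub (β t + b i) (β t + b j)
    rw [add_sub_add_left_eq_sub] at hcos hcosh
    simp only [hq, hw, hx, hY, hZ, hρ, hR, hcos, hcosh]
    ring
  intro i j t₁ t₂
  rw [key, key]
end
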